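/- arXiv:2504.15750 — 3 statements merged into one kernel-verified Lean document; each statement's English description precedes it below -/
import Mathlib

section
/- Let {([0,n], f_n)}_{n≥0} be a specification sequence on X = S^ℤ, let A ⊆ ℕ⁻ (the negative integers), and let x, y ∈ X with x_A = y_A. If (v_k)_{k≥0} is a nondecreasing sequence of strictly positive reals such that v_k ≤ inf_{i≥0} r̄_{A∪[0,i+k]}(f_i) for all k ≥ 0, then for all 0 ≤ k ≤ n with n ≥ 1: ρ_k^{(n)}(x,y) ≥ v_k·ρ_{k-1}^{(n-1)}(x,y) + ∑_{j=k}^{n-1} (v_{j+1} − v_j)·ρ_j^{(n-1)}(x,y) (the sum being empty when k = n). -/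
open MeasureTheory Filter Set Asymptotics

noncomputable section

namespace GibbsFormal

/-- The configuration space `X = S^ℤ`. -/
abbrev Conf (S : Type) := ℤ → S

variable {S : Type} [Fintype S] [Nonempty S] [DecidableEq S]
  [TopologicalSpace S] [DiscreteTopology S]
  [MeasurableSpace S] [MeasurableSingletonClass S]

/-- The configuration obtained from `x` by replacing its coordinates on `Λ` by `ζ`. -/
def ov (x : Conf S) (Λ : Finset ℤ) (ζ : Λ → S) : Conf S :=
  fun i => if h : i ∈ Λ then ζ ⟨i, h⟩ else x i

/-- The configuration `x'_Λ x_{Λᶜ}`, agreeing with `x'` on `Λ` and with `x` off `Λ`. -/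
def merge (Λ : Finset ℤ) (x' x : Conf S) : Conf S :=
  fun i => if i ∈ Λ then x' i else x i

/-- The configuration `s_n x`. -/
def upd (s : S) (n : ℤ) (x : Conf S) : Conf S :=
  fun i => if i = n then s else x i

/-- The shift `Tⁿ`:  `(Tⁿ x) i = x (i + n)`. -/
def shift (n : ℤ) (x : Conf S) : Conf S := fun i => x (i + n)

/-- The sub-σ-algebra `ℬ_Λ` of the Borel (= product) σ-algebra, generated by
coordinates in `Λ`. -/
def cylSA (Λ : Set ℤ) : MeasurableSpace (Conf S) :=
  MeasurableSpace.comap (fun x => Λ.restrict x) inferInstance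

/-- The cylinder set `[ζ]_Λ`. -/
def cylEvent (Λ : Finset ℤ) (ζ : Λ → S) : Set (Conf S) :=
  {y | ∀ i : Λ, y i = ζ i}

/-- `r_Λ(f) = sup {f x / f y : x_Λ = y_Λ}`. -/
def rSup (Λ : Set ℤ) (f : Conf S → ℝ) : ℝ :=
  sSup {r : ℝ | ∃ x y : Conf S, (∀ i ∈ Λ, x i = y i) ∧ f x / f y = r}

/-- `r̄_Λ(f) = inf {f x / f y : x_Λ = y_Λ}`. -/
def rInf (Λ : Set ℤ) (f : Conf S → ℝ) : ℝ :=
  sInf {r : ℝ | ∃ x y : Conf S, (∀ i ∈ Λ, x i = y i) ∧ f x / f y = r}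

/-- A specification `𝒱 = {φ_Λ}` on `S^ℤ`:  a family of nonnegative Borel functions
satisfying the normalisation and consistency conditions.  (The value on the empty set
is normalised to `1`, which is forced by the unguarded normalisation condition.) -/
structure Specification (A : Type) [Fintype A] [MeasurableSpace A] where
  φ : Finset ℤ → Conf A → ℝ
  nonneg : ∀ Λ x, 0 ≤ φ Λ x
  measurable : ∀ Λ, Measurable (φ Λ)
  sum_one : ∀ (Λ : Finset ℤ) (x : Conf A), ∑ ζ : Λ → A, φ Λ (ov x Λ ζ) = 1
  consistent : ∀ (K Λ : Finset ℤ), K ⊆ Λ → ∀ x : Conf A,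
    φ Λ x = φ K x * ∑ ζ : K → A, φ Λ (ov x K ζ)

/-- A positive specification. -/
def Specification.Positive (V : Specification S) : Prop := ∀ Λ x, 0 < V.φ Λ x

/-- A continuous specification. -/
def Specification.IsCont (V : Specification S) : Prop := ∀ Λ, Continuous (V.φ Λ)

/-- A `T`-invariant specification: `φ_{n+Λ}(x) = φ_Λ(Tⁿ x)`. -/
def Specification.TInvariant (V : Specification S) : Prop :=
  ∀ (n : ℤ) (Λ : Finset ℤ) (x : Conf S),
    V.φ (Λ.image fun i => n + i) x = V.φ Λ (shift n x)

/-- The DLR (Gibbs) condition for a family `φfam` of conditional probabilities: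
for each finite nonempty `Λ` and each pattern `ζ` on `Λ`, the conditional probability
of the cylinder `[ζ]_Λ` given `ℬ_{Λᶜ}` is `x ↦ φfam Λ (ζ x_{Λᶜ})`, `μ`-a.e. -/
def GibbsCond (φfam : Finset ℤ → Conf S → ℝ) (μ : Measure (Conf S)) : Prop :=
  ∀ (Λ : Finset ℤ), Λ.Nonempty → ∀ ζ : Λ → S,
    (fun x => φfam Λ (ov x Λ ζ)) =ᵐ[μ]
      μ[(cylEvent Λ ζ).indicator (fun _ => (1 : ℝ)) | cylSA ((↑Λ : Set ℤ)ᶜ)]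

/-- `μ` is a Gibbs state for the specification `V`. -/
def IsGibbs (V : Specification S) (μ : Measure (Conf S)) : Prop :=
  IsProbabilityMeasure μ ∧ GibbsCond V.φ μ

/-- `g ∈ 𝒢_X`: a nonnegative bounded `ℬ_{ℤ⁻}`-measurable function with
`∑_{s ∈ S} g (s_0 x) = 1`. -/
def MemG (g : Conf S → ℝ) : Prop :=
  (∃ C, ∀ x, |g x| ≤ C) ∧ (∀ x, 0 ≤ g x) ∧
    Measurable[cylSA (Set.Iic (0 : ℤ))] g ∧
    ∀ x : Conf S, ∑ s : S, g (upd s 0 x) = 1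

/-- `μ` is a `g`-chain: for every `n` the conditional probability of the symbol at
site `n` given `ℬ_{(-∞,n-1]}` is `x ↦ g (Tⁿ (s_n x))`, `μ`-a.e. -/
def IsGChain (g : Conf S → ℝ) (μ : Measure (Conf S)) : Prop :=
  IsProbabilityMeasure μ ∧ ∀ (n : ℤ) (s : S),
    (fun x => g (shift n (upd s n x))) =ᵐ[μ]
      μ[({y : Conf S | y n = s}).indicator (fun _ => (1 : ℝ)) | cylSA (Set.Iic (n - 1))]

/-- The probability `π^𝒱_{[0,n]}([x]_{{0}} | x)`. -/
def piG (V : Specification S) (n : ℕ) (x : Conf S) : ℝ :=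
  ∑ ζ : (Finset.Icc (0 : ℤ) (n : ℤ)) → S,
    V.φ (Finset.Icc (0 : ℤ) (n : ℤ)) (ov x (Finset.Icc (0 : ℤ) (n : ℤ)) ζ) *
      (if ov x (Finset.Icc (0 : ℤ) (n : ℤ)) ζ 0 = x 0 then 1 else 0)

/-- A specification sequence of the form `{([0,n], f_n)}`: each `f_n` is bounded,
strictly positive and `ℬ_{[0,n-1]ᶜ}`-measurable. -/
def IsSpecSeq (f : ℕ → Conf S → ℝ) : Prop :=
  ∀ n : ℕ, (∃ C, ∀ x, f n x ≤ C) ∧ (∀ x, 0 < f n x) ∧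
    Measurable[cylSA ((Set.Ico (0 : ℤ) (n : ℤ))ᶜ)] (f n)

/-- `{([0,n], f_n)}` is a specification sequence for the family `φfam`. -/
def IsSpecSeqForFam (φfam : Finset ℤ → Conf S → ℝ) (f : ℕ → Conf S → ℝ) : Prop :=
  IsSpecSeq f ∧ ∀ (n : ℕ) (x : Conf S),
    φfam (Finset.Icc (0 : ℤ) (n : ℤ)) x =
      (∏ j ∈ Finset.range (n + 1), f j x) /
        ∑ ζ : (Finset.Icc (0 : ℤ) (n : ℤ)) → S,
          ∏ j ∈ Finset.range (n + 1), f j (ov x (Finset.Icc (0 : ℤ) (n : ℤ)) ζ)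

/-- `{([0,n], f_n)}` is a specification sequence for the specification `V`. -/
def IsSpecSeqFor (V : Specification S) (f : ℕ → Conf S → ℝ) : Prop :=
  IsSpecSeqForFam V.φ f

/-- The operator `L_{m,n} h (x) = ∑_{y ∈ [x]_{[m,n]ᶜ}} (∏_{i=m}^n f_i y) · h y`. -/
def Lop (f : ℕ → Conf S → ℝ) (m n : ℕ) (h : Conf S → ℝ) (x : Conf S) : ℝ :=
  ∑ ζ : (Finset.Icc (m : ℤ) (n : ℤ)) → S,
    (∏ i ∈ Finset.Icc m n, f i (ov x (Finset.Icc (m : ℤ) (n : ℤ)) ζ)) *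
      h (ov x (Finset.Icc (m : ℤ) (n : ℤ)) ζ)

/-- The ratio bounds `ρ_k^{(n)}(x,y)` (with `ρ_{-1}^{(n)}` for negative `k`). -/
def rho (f : ℕ → Conf S → ℝ) (k : ℤ) (n : ℕ) (x y : Conf S) : ℝ :=
  if k < 0 then
    sInf {r : ℝ | ∃ m : ℕ,
      Lop f m (m + n) (fun _ => 1) x / Lop f m (m + n) (fun _ => 1) y = r}
  else
    sInf {r : ℝ | ∃ (m : ℕ) (ζ : (Finset.Icc (m : ℤ) ((m : ℤ) + k)) → S),
      Lop f m (m + n) ((cylEvent (Finset.Icc (m : ℤ) ((m : ℤ) + k)) ζ).indicator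
          fun _ => 1) x /
        Lop f m (m + n) ((cylEvent (Finset.Icc (m : ℤ) ((m : ℤ) + k)) ζ).indicator
          fun _ => 1) y = r}

/-- A `T`-invariant interaction potential `Φ = {Φ_Λ}`. -/
structure Potential (A : Type) [Fintype A] [MeasurableSpace A] where
  Φ : Finset ℤ → Conf A → ℝ
  measurable : ∀ Λ : Finset ℤ, Λ.Nonempty → Measurable[cylSA (↑Λ : Set ℤ)] (Φ Λ)
  bounded : ∀ Λ : Finset ℤ, ∃ C, ∀ x, |Φ Λ x| ≤ C
  invariant : ∀ (n : ℤ) (Λ : Finset ℤ), Λ.Nonempty → ∀ x : Conf A,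
    Φ (Λ.image fun i => n + i) x = Φ Λ (shift n x)

/-- `var(h) = sup h − inf h`. -/
def pvar (h : Conf S → ℝ) : ℝ := (⨆ x, h x) - ⨅ x, h x

/-- `‖h‖ = sup |h|`. -/
def pnorm (h : Conf S → ℝ) : ℝ := ⨆ x, |h x|

/-- `∑_{Λ ∋ 0} ‖Φ_Λ‖ < ∞`. -/
def NormSummable (P : Potential S) : Prop :=
  Summable fun Λ : {Λ : Finset ℤ // (0 : ℤ) ∈ Λ} => pnorm (P.Φ ↑Λ)

/-- `∑_{Λ ∋ 0, Λ ∩ [n,∞) ≠ ∅} var(Φ_Λ)`. -/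
def varTail (P : Potential S) (n : ℕ) : ℝ :=
  ∑' Λ : {Λ : Finset ℤ // (0 : ℤ) ∈ Λ ∧ ∃ i ∈ Λ, (n : ℤ) ≤ i}, pvar (P.Φ ↑Λ)

/-- The Hamiltonian `H_Λ(x) = ∑_{K ∩ Λ ≠ ∅} Φ_K(x)`. -/
def HPot (P : Potential S) (Λ : Finset ℤ) (x : Conf S) : ℝ :=
  ∑' K : {K : Finset ℤ // (K ∩ Λ).Nonempty}, P.Φ ↑K x

/-- The specification `𝒱_Φ` associated with an interaction potential. -/
def potPhi (P : Potential S) (Λ : Finset ℤ) (x : Conf S) : ℝ :=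
  Real.exp (-HPot P Λ x) / ∑ ζ : Λ → S, Real.exp (-HPot P Λ (ov x Λ ζ))

/-- `μ` is a Gibbs state for the potential `P`. -/
def IsGibbsPot (P : Potential S) (μ : Measure (Conf S)) : Prop :=
  IsProbabilityMeasure μ ∧ GibbsCond (potPhi P) μ

/-- `(T,μ)` is Bernoulli: the shift on `(S^ℤ, μ)` is measure-theoretically isomorphic
(mod 0) to the shift on `A^ℤ` carrying an i.i.d. product probability measure for some
finite alphabet `A` (wlog `A = Fin m`). -/
def IsBernoulliSystem (μ : Measure (Conf S)) : Prop :=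
  ∃ (m : ℕ) (p : Fin m → ENNReal) (ν : Measure (ℤ → Fin m)),
    IsProbabilityMeasure ν ∧ (∑ a, p a = 1) ∧
    (∀ (Λ : Finset ℤ) (ζ : Λ → Fin m),
      ν {y : ℤ → Fin m | ∀ i : Λ, y ↑i = ζ i} = ∏ i : Λ, p (ζ i)) ∧
    ∃ (θ : Conf S → ℤ → Fin m) (θinv : (ℤ → Fin m) → Conf S),
      Measurable θ ∧ Measurable θinv ∧ μ.map θ = ν ∧
      (∀ᵐ x ∂μ, θ (shift 1 x) = fun i => θ x (i + 1)) ∧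
      (∀ᵐ x ∂μ, θinv (θ x) = x) ∧ (∀ᵐ y ∂ν, θ (θinv y) = y)

/-- The recursively defined quantities `p_k^{(n)}` of Lemma 3.3 (`k = -1` is encoded
by any negative argument). -/
def pSeq (v : ℕ → ℝ) : ℕ → ℤ → ℝ
  | 0, k => if k < 0 then 1 else v 0
  | n + 1, k =>
    if k < 0 then 1
    else v k.toNat * pSeq v n (k - 1) +
      ∑ j ∈ Finset.Ico k.toNat (n + 1), (v (j + 1) - v j) * pSeq v n (j : ℤ)


section Auxiliary

theorem IsSpecSeq.dependsOn {α : Type} [MeasurableSpace α]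
    {f : ℕ → Conf α → ℝ} (hf : IsSpecSeq f) (n : ℕ) :
    DependsOn (f n) (Set.Ico (0 : ℤ) n)ᶜ := by
  intro a b hab
  obtain ⟨t, -, ht⟩ := (hf n).2.2 (measurableSet_singleton (f n b))
  have hres : (Set.Ico (0 : ℤ) n)ᶜ.domRestrict a = (Set.Ico (0 : ℤ) n)ᶜ.domRestrict b :=
    funext fun i => hab i i.2
  have hb : (Set.Ico (0 : ℤ) n)ᶜ.domRestrict b ∈ t := ht.ge (mem_singleton (f n b))
  exact ht.le (show (Set.Ico (0 : ℤ) n)ᶜ.domRestrict a ∈ t from hres ▸ hb)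

theorem sum_ov_insert {α : Type} [Fintype α] {Λ Λ' : Finset ℤ} {a : ℤ} (ha : a ∉ Λ')
    (hΛ : Λ = insert a Λ') (Φ : Conf α → ℝ) (x : Conf α) :
    ∑ ζ : Λ → α, Φ (ov x Λ ζ) = ∑ s : α, ∑ z : Λ' → α, Φ (upd s a (ov x Λ' z)) := by
  subst hΛ
  rw [← Fintype.sum_prod_type' (f := fun s z => Φ (upd s a (ov x Λ' z)))]
  refine Fintype.sum_bijective
    (fun ζ => (ζ ⟨a, Finset.mem_insert_self a Λ'⟩,
      fun i => ζ ⟨i, Finset.mem_insert_of_mem i.2⟩)) ⟨?_, ?_⟩ _ _ ?_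
  · intro ζ η h
    rw [Prod.mk.injEq] at h
    funext ⟨i, hi⟩
    rcases Finset.mem_insert.1 hi with rfl | hi'
    · exact h.1
    · exact congrFun h.2 ⟨i, hi'⟩
  · rintro ⟨s, z⟩
    refine ⟨fun i => if h : i.1 ∈ Λ' then z ⟨i, h⟩ else s, ?_⟩
    simp [ha]
  · intro ζ
    congr 1
    funext i
    by_cases hia : i = a
    · subst hia
      simp [ov, upd]
    · by_cases hi : i ∈ Λ' <;> simp [ov, upd, hia, hi]

theorem Lop_nonneg {α : Type} [Fintype α] {f : ℕ → Conf α → ℝ} (hf : ∀ n x, 0 < f n x)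
    (m n : ℕ) {h : Conf α → ℝ} (hh : ∀ w, 0 ≤ h w) (x : Conf α) : 0 ≤ Lop f m n h x :=
  Finset.sum_nonneg fun _ _ => mul_nonneg (Finset.prod_nonneg fun _ _ => (hf _ _).le) (hh _)

theorem Lop_pos {α : Type} [Fintype α] {f : ℕ → Conf α → ℝ} (hf : ∀ n x, 0 < f n x)
    {m n : ℕ} {h : Conf α → ℝ} (hh : ∀ w, 0 ≤ h w) {x : Conf α}
    (z : Finset.Icc (m : ℤ) (n : ℤ) → α) (hz : 0 < h (ov x (Finset.Icc (m : ℤ) (n : ℤ)) z)) :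
    0 < Lop f m n h x :=
  Finset.sum_pos'
    (fun _ _ => mul_nonneg (Finset.prod_nonneg fun _ _ => (hf _ _).le) (hh _))
    ⟨z, Finset.mem_univ _, mul_pos (Finset.prod_pos fun _ _ => hf _ _) hz⟩

theorem Lop_mono {α : Type} [Fintype α] {f : ℕ → Conf α → ℝ} (hf : ∀ n x, 0 < f n x)
    {m n : ℕ} {h h' : Conf α → ℝ} {x : Conf α}
    (hh : ∀ z, h (ov x (Finset.Icc (m : ℤ) (n : ℤ)) z) ≤
      h' (ov x (Finset.Icc (m : ℤ) (n : ℤ)) z)) :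
    Lop f m n h x ≤ Lop f m n h' x :=
  Finset.sum_le_sum fun _ _ =>
    mul_le_mul_of_nonneg_left (hh _) (Finset.prod_nonneg fun _ _ => (hf _ _).le)

theorem Lop_sub {α : Type} [Fintype α] (f : ℕ → Conf α → ℝ) (m n : ℕ) (h h' : Conf α → ℝ)
    (x : Conf α) : Lop f m n (fun w => h w - h' w) x = Lop f m n h x - Lop f m n h' x := by
  simp only [Lop, mul_sub, Finset.sum_sub_distrib]

theorem Lop_const_mul {α : Type} [Fintype α] (f : ℕ → Conf α → ℝ) (m n : ℕ) (c : ℝ)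
    (h : Conf α → ℝ) (x : Conf α) :
    Lop f m n (fun w => c * h w) x = c * Lop f m n h x := by
  simp only [Lop, Finset.mul_sum]
  exact Finset.sum_congr rfl fun _ _ => by ring

theorem Lop_sum {α ι : Type} [Fintype α] (f : ℕ → Conf α → ℝ) (m n : ℕ) (s : Finset ι)
    (h : ι → Conf α → ℝ) (x : Conf α) :
    Lop f m n (fun w => ∑ i ∈ s, h i w) x = ∑ i ∈ s, Lop f m n (h i) x := by
  simp only [Lop, Finset.mul_sum]
  exact Finset.sum_comm

theorem indicator_cylEvent_nonneg {α : Type} (Λ : Finset ℤ) (ζ : Λ → α) (w : Conf α) :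
    0 ≤ (cylEvent Λ ζ).indicator (fun _ => (1 : ℝ)) w :=
  indicator_nonneg (fun _ _ => zero_le_one) w

theorem ov_mem_cylEvent {α : Type} (x : Conf α) (Λ : Finset ℤ) (ζ : Λ → α) :
    ov x Λ ζ ∈ cylEvent Λ ζ := fun i => by simp [ov]

theorem mem_cylEvent_congr {α : Type} {Λ : Finset ℤ} (ζ : Λ → α) {w w' : Conf α}
    (h : ∀ i ∈ Λ, w i = w' i) : w ∈ cylEvent Λ ζ ↔ w' ∈ cylEvent Λ ζ :=
  forall_congr' fun i => by rw [h i i.2]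

/-- The cylinder over a subinterval of the window has positive weight. -/
theorem Lop_indicator_cylEvent_pos {α : Type} [Fintype α] [Nonempty α]
    {f : ℕ → Conf α → ℝ} (hf : ∀ n x, 0 < f n x) {m n : ℕ} {Λ : Finset ℤ}
    (hΛ : Λ ⊆ Finset.Icc (m : ℤ) (n : ℤ)) (ζ : Λ → α) (x : Conf α) :
    0 < Lop f m n ((cylEvent Λ ζ).indicator fun _ => 1) x := by
  refine Lop_pos hf (indicator_cylEvent_nonneg Λ ζ) (fun i => ov x Λ ζ i) ?_
  rw [indicator_of_mem]
  · exact one_pos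
  · refine (mem_cylEvent_congr ζ fun i hi => ?_).2 (ov_mem_cylEvent x Λ ζ)
    simp only [ov, hΛ hi, hi, dif_pos]

theorem cylEvent_eq_univ {α : Type} {Λ : Finset ℤ} (hΛ : Λ = ∅) (ζ : Λ → α) :
    cylEvent Λ ζ = Set.univ := by
  subst hΛ
  exact eq_univ_of_forall fun w i => absurd i.2 (Finset.notMem_empty _)

/-- Both branches of `rho` are infima over cylinders: for negative `k` the cylinder is the
whole space. -/
theorem rho_eq_sInf {α : Type} [Fintype α] [Nonempty α] (f : ℕ → Conf α → ℝ)
    (k : ℤ) (n : ℕ) (x y : Conf α) :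
    rho f k n x y =
      sInf {r : ℝ | ∃ (m : ℕ) (ζ : (Finset.Icc (m : ℤ) ((m : ℤ) + k)) → α),
        Lop f m (m + n) ((cylEvent (Finset.Icc (m : ℤ) ((m : ℤ) + k)) ζ).indicator
            fun _ => 1) x /
          Lop f m (m + n) ((cylEvent (Finset.Icc (m : ℤ) ((m : ℤ) + k)) ζ).indicator
            fun _ => 1) y = r} := by
  unfold rho
  split_ifs with hk
  · have h1 : ∀ (m : ℕ) (ζ : (Finset.Icc (m : ℤ) ((m : ℤ) + k)) → α),
        (cylEvent (Finset.Icc (m : ℤ) ((m : ℤ) + k)) ζ).indicator (fun _ => (1 : ℝ)) =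
          fun _ => 1 := fun m ζ => by
      rw [cylEvent_eq_univ (Finset.Icc_eq_empty (by omega)) ζ, indicator_univ]
    simp only [h1, exists_const]
  · rfl

theorem rho_nonneg {α : Type} [Fintype α] [Nonempty α] {f : ℕ → Conf α → ℝ}
    (hf : ∀ n x, 0 < f n x) (k : ℤ) (n : ℕ) (x y : Conf α) : 0 ≤ rho f k n x y := by
  rw [rho_eq_sInf]
  refine Real.sInf_nonneg ?_
  rintro r ⟨m, ζ, rfl⟩
  exact div_nonneg (Lop_nonneg hf _ _ (indicator_cylEvent_nonneg _ _) _)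
    (Lop_nonneg hf _ _ (indicator_cylEvent_nonneg _ _) _)

theorem rho_mul_Lop_indicator_le {α : Type} [Fintype α] [Nonempty α] {f : ℕ → Conf α → ℝ}
    (hf : ∀ n x, 0 < f n x) (k : ℤ) (m n : ℕ) (x y : Conf α)
    (ζ : Finset.Icc (m : ℤ) ((m : ℤ) + k) → α) :
    rho f k n x y * Lop f m (m + n) ((cylEvent _ ζ).indicator fun _ => 1) y ≤
      Lop f m (m + n) ((cylEvent _ ζ).indicator fun _ => 1) x := by
  have hx := Lop_nonneg hf m (m + n) (indicator_cylEvent_nonneg _ ζ) x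
  rcases (Lop_nonneg hf m (m + n) (indicator_cylEvent_nonneg _ ζ) y).eq_or_lt with hy | hy
  · rw [← hy, mul_zero]
    exact hx
  · rw [← le_div_iff₀ hy, rho_eq_sInf]
    refine csInf_le ⟨0, ?_⟩ ⟨m, ζ, rfl⟩
    rintro r ⟨m', ζ', rfl⟩
    exact div_nonneg (Lop_nonneg hf _ _ (indicator_cylEvent_nonneg _ _) _)
      (Lop_nonneg hf _ _ (indicator_cylEvent_nonneg _ _) _)

theorem _root_.DependsOn.eq_sum_indicator_cylEvent {α : Type} [Fintype α] {Λ : Finset ℤ}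
    {h : Conf α → ℝ} (hdep : DependsOn h (Λ : Set ℤ)) (x : Conf α) :
    h = fun w => ∑ ζ : Λ → α, h (ov x Λ ζ) * (cylEvent Λ ζ).indicator (fun _ => 1) w := by
  funext w
  rw [Finset.sum_eq_single (fun i : Λ => w i)]
  · rw [indicator_of_mem (show w ∈ cylEvent Λ (fun i : Λ => w i) from fun _ => rfl), mul_one]
    refine hdep fun i hi => ?_
    simp [ov, Finset.mem_coe.1 hi]
  · intro ζ _ hζ
    rw [indicator_of_notMem, mul_zero]
    exact fun hw => hζ (funext fun i => (hw i).symm)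
  · exact fun h => absurd (Finset.mem_univ _) h

theorem rho_mul_Lop_le {α : Type} [Fintype α] [Nonempty α] {f : ℕ → Conf α → ℝ}
    (hf : ∀ n x, 0 < f n x) (k : ℤ) (m n : ℕ) (x y : Conf α) {h : Conf α → ℝ}
    (hh : ∀ w, 0 ≤ h w) (hdep : DependsOn h (Set.Icc (m : ℤ) ((m : ℤ) + k))) :
    rho f k n x y * Lop f m (m + n) h y ≤ Lop f m (m + n) h x := by
  rw [← Finset.coe_Icc] at hdep
  rw [hdep.eq_sum_indicator_cylEvent x, Lop_sum, Lop_sum, Finset.mul_sum]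
  refine Finset.sum_le_sum fun ζ _ => ?_
  rw [Lop_const_mul, Lop_const_mul, mul_left_comm]
  exact mul_le_mul_of_nonneg_left (rho_mul_Lop_indicator_le hf k m n x y ζ) (hh _)

theorem rho_le_rho_sub_one {α : Type} [Fintype α] [Nonempty α] {f : ℕ → Conf α → ℝ}
    (hf : ∀ n x, 0 < f n x) {k : ℤ} {n : ℕ} (hk : k ≤ n) (x y : Conf α) :
    rho f k n x y ≤ rho f (k - 1) n x y := by
  rw [rho_eq_sInf f (k - 1)]
  refine le_csInf ⟨_, 0, fun _ => Classical.arbitrary α, rfl⟩ ?_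
  rintro r ⟨m, ζ, rfl⟩
  rw [le_div_iff₀]
  · refine rho_mul_Lop_le hf k m n x y (indicator_cylEvent_nonneg _ ζ) fun a b hab => ?_
    refine indicator_const_eq_indicator_const (mem_cylEvent_congr ζ fun i hi => hab i ?_)
    rw [Finset.mem_Icc] at hi
    exact ⟨hi.1, by omega⟩
  · exact Lop_indicator_cylEvent_pos hf (Finset.Icc_subset_Icc_right (by push_cast; omega)) ζ y

theorem mul_le_of_le_rInf {α : Type} {Λ : Set ℤ} {g : Conf α → ℝ} (hg : ∀ w, 0 < g w)
    {c : ℝ} (hc : c ≤ rInf Λ g) {a b : Conf α} (hab : ∀ i ∈ Λ, a i = b i) :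
    c * g b ≤ g a := by
  rw [← le_div_iff₀ (hg b)]
  refine hc.trans (csInf_le ⟨0, ?_⟩ ⟨a, b, hab, rfl⟩)
  rintro r ⟨a', b', -, rfl⟩
  exact (div_pos (hg a') (hg b')).le

theorem iInf_rInf_le {α : Type} {f : ℕ → Conf α → ℝ} (hf : ∀ n w, 0 < f n w)
    (Λ : ℕ → Set ℤ) (m : ℕ) : ⨅ i, rInf (Λ i) (f i) ≤ rInf (Λ m) (f m) := by
  refine ciInf_le ⟨0, ?_⟩ m
  rintro r ⟨i, rfl⟩
  refine Real.sInf_nonneg ?_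
  rintro r ⟨a, b, -, rfl⟩
  exact (div_pos (hf i a) (hf i b)).le

/-- Summing out the leftmost site of the window against a cylinder. -/
theorem Lop_indicator_cylEvent_eq {α : Type} [Fintype α] [MeasurableSpace α]
    {f : ℕ → Conf α → ℝ} (hf : IsSpecSeq f) (m N : ℕ) {Λ : Finset ℤ} (hm : (m : ℤ) ∈ Λ)
    (ζ : Λ → α) (x : Conf α) :
    Lop f m (m + (N + 1)) ((cylEvent Λ ζ).indicator fun _ => 1) x =
      Lop f (m + 1) (m + 1 + N) (fun w => f m (upd (ζ ⟨m, hm⟩) m w) *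
        (cylEvent Λ ζ).indicator (fun _ => 1) (upd (ζ ⟨m, hm⟩) m w)) x := by
  have hsplit : Finset.Icc (m : ℤ) ((m + (N + 1) : ℕ) : ℤ) =
      insert (m : ℤ) (Finset.Icc ((m + 1 : ℕ) : ℤ) ((m + 1 + N : ℕ) : ℤ)) := by
    ext i
    simp only [Finset.mem_Icc, Finset.mem_insert]
    omega
  have hprod : Finset.Icc m (m + (N + 1)) = insert m (Finset.Icc (m + 1) (m + 1 + N)) := by
    ext i
    simp only [Finset.mem_Icc, Finset.mem_insert]
    omega
  have hupd : ∀ i ∈ Finset.Icc (m + 1) (m + 1 + N), ∀ s w, f i (upd s m w) = f i w := by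
    intro i hi s w
    refine hf.dependsOn i fun j hj => ?_
    rw [upd, if_neg]
    rintro rfl
    rw [Finset.mem_Icc] at hi
    exact hj ⟨by omega, by omega⟩
  unfold Lop
  rw [sum_ov_insert (by simp) hsplit (fun w => (∏ i ∈ Finset.Icc m (m + (N + 1)), f i w) *
    (cylEvent Λ ζ).indicator (fun _ => 1) w) x, Finset.sum_eq_single (ζ ⟨m, hm⟩)]
  · refine Finset.sum_congr rfl fun z _ => ?_
    rw [hprod, Finset.prod_insert (by simp), Finset.prod_congr rfl fun i hi => hupd i hi _ _]
    ring
  · intro s _ hs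
    refine Finset.sum_eq_zero fun z _ => ?_
    rw [indicator_of_notMem, mul_zero]
    exact fun hw => hs (by simpa [upd] using hw ⟨m, hm⟩)
  · exact fun h => absurd (Finset.mem_univ _) h

/-- Take `w` on `[a,b]`, `x` off `[a,c]`, and `u` in between. -/
def splice (x w u : Conf S) (a b c : ℤ) : Conf S :=
  fun i => if i ∈ Set.Icc a b then w i else if i ∈ Set.Icc a c then u i else x i

/-- The largest minorant of `g`, on configurations with boundary `x` off `[a,c]`, which depends
only on `[a,b]`. -/
def localInf (g : Conf S → ℝ) (x : Conf S) (a c b : ℤ) (w : Conf S) : ℝ :=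
  ⨅ u : Conf S, g (splice x w u a b c)

theorem localInf_dependsOn {α : Type} (g : Conf α → ℝ) (x : Conf α) (a c b : ℤ) :
    DependsOn (localInf g x a c b) (Set.Icc a b) := by
  intro w w' h
  refine iInf_congr fun u => congrArg g (funext fun i => ?_)
  by_cases hi : i ∈ Set.Icc a b
  · rw [splice, splice, if_pos hi, if_pos hi, h i hi]
  · rw [splice, splice, if_neg hi, if_neg hi]

theorem localInf_mono {α : Type} [Nonempty α] {g : Conf α → ℝ} (hg : ∀ w, 0 ≤ g w)
    (x : Conf α) {a b b' c : ℤ} (hb : b ≤ b') (hc : b' ≤ c) (w : Conf α) :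
    localInf g x a c b w ≤ localInf g x a c b' w := by
  refine le_ciInf fun u => ?_
  have hbdd : BddBelow (range fun u => g (splice x w u a b c)) :=
    ⟨0, by rintro r ⟨u, rfl⟩; exact hg _⟩
  refine (ciInf_le hbdd (splice x w u a b' c)).trans_eq (congrArg g (funext fun i => ?_))
  simp only [splice, Set.mem_Icc]
  grind

theorem localInf_nonneg {α : Type} {g : Conf α → ℝ} (hg : ∀ w, 0 ≤ g w)
    (x : Conf α) (a c b : ℤ) (w : Conf α) : 0 ≤ localInf g x a c b w :=
  Real.iInf_nonneg fun _ => hg _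

theorem localInf_self {α : Type} [Nonempty α] (g : Conf α → ℝ) {x w : Conf α} {a c : ℤ}
    (hw : ∀ i ∉ Set.Icc a c, w i = x i) : localInf g x a c c w = g w := by
  have h : ∀ u, splice x w u a c c = w := fun u => by
    funext i
    by_cases hi : i ∈ Set.Icc a c
    · rw [splice, if_pos hi]
    · rw [splice, if_neg hi, if_neg hi, hw i hi]
  simp only [localInf, h, ciInf_const]

/-- Summation by parts for the telescoping lower bound. -/
theorem summation_by_parts_bound {v r a b : ℕ → ℝ} {e : ℝ} {k : ℕ} (hk : r k * a k ≤ b k)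
    (hr : ∀ j, 0 ≤ r j) (ha : ∀ j, k ≤ j → v j * e ≤ a j) {n : ℕ} (hkn : k ≤ n)
    (hanti : ∀ j, k ≤ j → j < n → r (j + 1) ≤ r j)
    (hstep : ∀ j, k ≤ j → j < n → r (j + 1) * (a (j + 1) - a j) ≤ b (j + 1) - b j) :
    (v k * r k + ∑ j ∈ Finset.Ico k n, (v (j + 1) - v j) * r (j + 1)) * e ≤ b n := by
  suffices h : (v k * r k + ∑ j ∈ Finset.Ico k n, (v (j + 1) - v j) * r (j + 1)) * e +
      r n * (a n - v n * e) ≤ b n by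
    have := mul_nonneg (hr n) (sub_nonneg.2 (ha n hkn))
    linarith
  induction n, hkn using Nat.le_induction with
  | base =>
    rw [Finset.Ico_self, Finset.sum_empty]
    linarith
  | succ n hkn ih =>
    have h1 := ih (fun j h h' => hanti j h (by omega)) (fun j h h' => hstep j h (by omega))
    have h2 := hstep n hkn (by omega)
    have h3 := mul_le_mul_of_nonneg_right (hanti n hkn (by omega)) (sub_nonneg.2 (ha n hkn))
    rw [Finset.sum_Ico_succ_top hkn]
    linarith

end Auxiliary

/-- **Lemma 3.2.**  The recursive lower bound for the ratio bounds `ρ_k^{(n)}`. -/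
theorem rho_recursive_bound
    {S : Type} [Fintype S] [Nonempty S] [DecidableEq S]
    [TopologicalSpace S] [DiscreteTopology S]
    [MeasurableSpace S] [MeasurableSingletonClass S]
    (f : ℕ → Conf S → ℝ) (hf : IsSpecSeq f)
    (A : Set ℤ) (hA : A ⊆ Set.Iio (0 : ℤ))
    (x y : Conf S) (hxy : ∀ i ∈ A, x i = y i)
    (v : ℕ → ℝ) (hmono : Monotone v) (hvpos : ∀ k, 0 < v k)
    (hle : ∀ k : ℕ, v k ≤ ⨅ i : ℕ, rInf (A ∪ Set.Icc (0 : ℤ) ((i : ℤ) + (k : ℤ))) (f i)) :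
    ∀ k n : ℕ, k ≤ n → 1 ≤ n →
      v k * rho f ((k : ℤ) - 1) (n - 1) x y +
          ∑ j ∈ Finset.Ico k n, (v (j + 1) - v j) * rho f (j : ℤ) (n - 1) x y
        ≤ rho f (k : ℤ) n x y := by
  intro k n hkn hn
  obtain ⟨N, rfl⟩ : ∃ N, n = N + 1 := ⟨n - 1, by omega⟩
  rw [Nat.add_sub_cancel, rho_eq_sInf f k]
  have hpos : ∀ n w, 0 < f n w := fun n => (hf n).2.1
  refine le_csInf ⟨_, 0, fun _ => Classical.arbitrary S, rfl⟩ ?_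
  rintro r ⟨m, ζ, rfl⟩
  have hm : (m : ℤ) ∈ Finset.Icc (m : ℤ) (m + k) := by simp
  rw [le_div_iff₀ (Lop_indicator_cylEvent_pos hpos
    (Finset.Icc_subset_Icc_right (by push_cast; omega)) ζ y),
    Lop_indicator_cylEvent_eq hf m N hm, Lop_indicator_cylEvent_eq hf m N hm]
  set s := ζ ⟨m, hm⟩
  set g : Conf S → ℝ := fun w => f m (upd s m w) with hg_def
  set χ : Conf S → ℝ := fun w => (cylEvent _ ζ).indicator (fun _ => 1) (upd s m w)
  set F : ℕ → Conf S → ℝ := fun j =>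
    localInf g x ((m + 1 : ℕ) : ℤ) ((m + 1 + N : ℕ) : ℤ) (m + j) with hF_def
  have hg : ∀ w, 0 ≤ g w := fun w => (hpos _ _).le
  have hχ : ∀ w, 0 ≤ χ w := fun w => indicator_cylEvent_nonneg _ ζ _
  have hF : ∀ j w, 0 ≤ F j w := fun j => localInf_nonneg hg _ _ _ _
  have hFdep : ∀ j, DependsOn (F j) (Set.Icc ((m + 1 : ℕ) : ℤ) (m + j)) := fun j =>
    localInf_dependsOn _ _ _ _ _
  have hχdep : DependsOn χ (Set.Icc ((m + 1 : ℕ) : ℤ) (m + k)) := by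
    intro a b hab
    refine indicator_const_eq_indicator_const (mem_cylEvent_congr ζ fun i hi => ?_)
    rw [Finset.mem_Icc] at hi
    by_cases him : i = m
    · simp [upd, him]
    · rw [upd, upd, if_neg him, if_neg him]
      exact hab i ⟨by push_cast; omega, hi.2⟩
  have hFn : Lop f (m + 1) (m + 1 + N) (fun w => g w * χ w) x =
      Lop f (m + 1) (m + 1 + N) (fun w => F (N + 1) w * χ w) x := by
    refine Finset.sum_congr rfl fun z _ => ?_
    have hc : (m : ℤ) + ((N + 1 : ℕ) : ℤ) = ((m + 1 + N : ℕ) : ℤ) := by push_cast; ring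
    simp only [hF_def, hc]
    rw [localInf_self g fun i hi => ?_]
    rw [ov, dif_neg]
    rwa [Finset.mem_Icc]
  have hlow : ∀ j z, v j * g (ov y (Finset.Icc ((m + 1 : ℕ) : ℤ) ((m + 1 + N : ℕ) : ℤ)) z) ≤
      F j (ov y (Finset.Icc ((m + 1 : ℕ) : ℤ) ((m + 1 + N : ℕ) : ℤ)) z) := by
    intro j z
    refine le_ciInf fun u => ?_
    set w := ov y (Finset.Icc ((m + 1 : ℕ) : ℤ) ((m + 1 + N : ℕ) : ℤ)) z with hw_def
    set a := upd s m (splice x w u ((m + 1 : ℕ) : ℤ) (m + j) ((m + 1 + N : ℕ) : ℤ)) with ha_def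
    have hw : ∀ i : ℤ, i < m + 1 → w i = y i := fun i hi => by
      rw [hw_def, ov, dif_neg]
      rw [Finset.mem_Icc]
      push_cast
      omega
    have ha : ∀ i : ℤ, i < m → a i = x i := fun i hi => by
      rw [ha_def, upd, if_neg hi.ne, splice, if_neg, if_neg] <;>
      · rw [Set.mem_Icc]
        push_cast
        omega
    have hb : f m (upd s m w) =
        f m (fun i => if i ∈ Set.Ico (0 : ℤ) m then a i else upd s m w i) :=
      hf.dependsOn m fun i hi => (if_neg hi).symm
    rw [hg_def]
    simp only
    rw [hb]
    refine mul_le_of_le_rInf (hpos m) ((hle j).trans (iInf_rInf_le hpos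
      (fun i => A ∪ Set.Icc (0 : ℤ) ((i : ℤ) + (j : ℤ))) m)) fun i hi => ?_
    by_cases hi0 : i ∈ Set.Ico (0 : ℤ) m
    · rw [if_pos hi0]
    · rw [if_neg hi0]
      rw [Set.mem_Ico] at hi0
      rcases hi with hiA | hi
      · have hneg : i < 0 := hA hiA
        refine (ha i (by omega)).trans ?_
        rw [upd, if_neg (by omega), hw i (by omega), hxy i hiA]
      · rw [Set.mem_Icc] at hi
        rw [upd, upd]
        by_cases him : i = m
        · rw [if_pos him, if_pos him]
        · rw [if_neg him, if_neg him, splice, if_pos]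
          rw [Set.mem_Icc]
          push_cast
          omega
  have hbound := summation_by_parts_bound (r := fun j => rho f ((j : ℤ) - 1) N x y) (v := v)
    (a := fun j => Lop f (m + 1) (m + 1 + N) (fun w => F j w * χ w) y)
    (b := fun j => Lop f (m + 1) (m + 1 + N) (fun w => F j w * χ w) x)
    (e := Lop f (m + 1) (m + 1 + N) (fun w => g w * χ w) y) ?_ ?_ ?_ hkn ?_ ?_
  · simp only [Nat.cast_add, Nat.cast_one, add_sub_cancel_right] at hbound
    exact hbound.trans_eq hFn.symm
  · refine rho_mul_Lop_le hpos _ _ _ x y (fun w => mul_nonneg (hF k w) (hχ w)) ?_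
    intro a b hab
    have h : ∀ i ∈ Set.Icc ((m + 1 : ℕ) : ℤ) (m + k), a i = b i := fun i hi =>
      hab i ⟨hi.1, by have := hi.2; push_cast; omega⟩
    simp only [hFdep k h, hχdep h]
  · exact fun j => rho_nonneg hpos _ _ _ _
  · intro j _
    rw [← Lop_const_mul]
    refine Lop_mono hpos fun z => ?_
    rw [← mul_assoc]
    exact mul_le_mul_of_nonneg_right (hlow j z) (hχ _)
  · intro j _ hj
    have := rho_le_rho_sub_one hpos (k := j) (n := N) (by omega) x y
    simpa using this
  · intro j hkj hj
    rw [← Lop_sub, ← Lop_sub]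
    refine rho_mul_Lop_le hpos _ _ _ x y (fun w => ?_) ?_
    · rw [← sub_mul]
      exact mul_nonneg (sub_nonneg.2 (localInf_mono hg x (by push_cast; omega)
        (by push_cast; omega) w)) (hχ w)
    · intro a b hab
      have h : ∀ l : ℕ, l ≤ j + 1 → ∀ i ∈ Set.Icc ((m + 1 : ℕ) : ℤ) (m + l), a i = b i :=
        fun l hl i hi => hab i ⟨hi.1, by have := hi.2; push_cast; omega⟩
      simp only [hFdep j (h j (by omega)), hFdep (j + 1) (h _ le_rfl), hχdep (h k (by omega))]
end GibbsFormal
end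
end

section
/- Let (v_k)_{k≥0} be a nondecreasing sequence of reals with 0 < v_k ≤ 1, and define p_k^{(n)} for −1 ≤ k ≤ n, n ≥ 0, recursively by p_{-1}^{(n)} = 1, p_0^{(0)} = v_0, and p_k^{(n)} = v_k·p_{k-1}^{(n-1)} + ∑_{j=k}^{n-1} (v_{j+1} − v_j)·p_j^{(n-1)} for 0 ≤ k ≤ n, n ≥ 1 (the sum being empty when k = n). Then the sequence (p_0^{(n)})_n is nondecreasing, its limit p_0 = lim_{n→∞} p_0^{(n)} exists, and p_0 ≥ lim_{n→∞} (∑_{k=0}^n ∏_{j=0}^k v_j)·(1 + ∑_{k=0}^n ∏_{j=0}^k v_j)⁻¹; in particular, if ∑_{k=0}^∞ ∏_{j=0}^k v_j = ∞ then p_0 = 1. -/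
open MeasureTheory Filter Set Asymptotics

noncomputable section

namespace GibbsFormal

variable {S : Type} [Fintype S] [Nonempty S] [DecidableEq S]
  [TopologicalSpace S] [DiscreteTopology S]
  [MeasurableSpace S] [MeasurableSingletonClass S]

theorem pSeq_of_neg (v : ℕ → ℝ) (n : ℕ) {k : ℤ} (hk : k < 0) : pSeq v n k = 1 := by
  cases n <;> simp [pSeq, hk]

theorem pSeq_succ_natCast (v : ℕ → ℝ) (n k : ℕ) :
    pSeq v (n + 1) k = v k * pSeq v n ((k : ℤ) - 1) +
      ∑ j ∈ Finset.Ico k (n + 1), (v (j + 1) - v j) * pSeq v n (j : ℤ) := by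
  simp [pSeq]

theorem pSeq_mem_Icc {v : ℕ → ℝ} (hmono : Monotone v) (hv0 : ∀ k, 0 ≤ v k)
    (hv1 : ∀ k, v k ≤ 1) (n : ℕ) (k : ℤ) : pSeq v n k ∈ Icc (0 : ℝ) 1 := by
  induction n generalizing k with
  | zero =>
    unfold pSeq
    split_ifs
    · simp
    · exact ⟨hv0 0, hv1 0⟩
  | succ n ih =>
    rcases lt_or_ge k 0 with hk | hk
    · simp [pSeq_of_neg v _ hk]
    lift k to ℕ using hk
    have hd : ∀ j, 0 ≤ v (j + 1) - v j := fun j => sub_nonneg.2 (hmono j.le_succ)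
    rw [pSeq_succ_natCast]
    refine ⟨add_nonneg (mul_nonneg (hv0 k) (ih _).1)
      (Finset.sum_nonneg fun j _ => mul_nonneg (hd j) (ih _).1), ?_⟩
    have h1 : v k * pSeq v n ((k : ℤ) - 1) ≤ v k := mul_le_of_le_one_right (hv0 k) (ih _).2
    have h2 : ∑ j ∈ Finset.Ico k (n + 1), (v (j + 1) - v j) * pSeq v n (j : ℤ) ≤
        ∑ j ∈ Finset.Ico k (n + 1), (v (j + 1) - v j) :=
      Finset.sum_le_sum fun j _ => mul_le_of_le_one_right (hd j) (ih _).2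
    rcases le_or_gt k (n + 1) with hkn | hkn
    · rw [Finset.sum_Ico_sub v hkn] at h2
      linarith [hv1 (n + 1)]
    · rw [Finset.Ico_eq_empty_of_le hkn.le] at h2 ⊢
      simp only [Finset.sum_empty] at h2 ⊢
      linarith [hv1 k]

theorem pSeq_le_pSeq_succ {v : ℕ → ℝ} (hmono : Monotone v) (hv0 : ∀ k, 0 ≤ v k)
    (hv1 : ∀ k, v k ≤ 1) (n : ℕ) {k : ℤ} (hkn : k ≤ n) :
    pSeq v n k ≤ pSeq v (n + 1) k := by
  have hd : ∀ j, 0 ≤ v (j + 1) - v j := fun j => sub_nonneg.2 (hmono j.le_succ)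
  have hp := fun n k => (pSeq_mem_Icc hmono hv0 hv1 n k).1
  induction n generalizing k with
  | zero =>
    rcases lt_or_ge k 0 with hk | hk
    · simp [pSeq_of_neg v _ hk]
    obtain rfl : k = 0 := le_antisymm (by simpa using hkn) hk
    simpa [pSeq] using mul_nonneg (hd 0) (hv0 0)
  | succ n ih =>
    rcases lt_or_ge k 0 with hk | hk
    · simp [pSeq_of_neg v _ hk]
    lift k to ℕ using hk
    have hkn' : k ≤ n + 1 := by exact_mod_cast hkn
    rw [pSeq_succ_natCast v n, pSeq_succ_natCast v (n + 1), Finset.sum_Ico_succ_top hkn']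
    have h1 := mul_le_mul_of_nonneg_left (ih (k := (k : ℤ) - 1) (by omega)) (hv0 k)
    have h2 : ∑ j ∈ Finset.Ico k (n + 1), (v (j + 1) - v j) * pSeq v n (j : ℤ) ≤
        ∑ j ∈ Finset.Ico k (n + 1), (v (j + 1) - v j) * pSeq v (n + 1) (j : ℤ) := by
      refine Finset.sum_le_sum fun j hj => mul_le_mul_of_nonneg_left (ih ?_) (hd j)
      have := (Finset.mem_Ico.1 hj).2
      omega
    linarith [mul_nonneg (hd (n + 1)) (hp (n + 1) ((n + 1 : ℕ) : ℤ))]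

theorem pSeq_pred_sub_pSeq (v : ℕ → ℝ) (n k : ℕ) :
    pSeq v (n + k) ((k : ℤ) - 1) - pSeq v (n + k) k =
      (∏ j ∈ Finset.range k, v j) * (1 - pSeq v n 0) := by
  induction k with
  | zero => simp [pSeq_of_neg v n (show (-1 : ℤ) < 0 by norm_num)]
  | succ k ih =>
    have hk : (((k + 1 : ℕ) : ℤ) - 1) = (k : ℤ) := by push_cast; ring
    rw [hk, ← add_assoc, pSeq_succ_natCast, pSeq_succ_natCast, hk,
      Finset.sum_eq_sum_Ico_succ_bot (show k < n + k + 1 by omega), Finset.prod_range_succ]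
    linear_combination v k * ih

theorem pSeq_self (v : ℕ → ℝ) (n : ℕ) : pSeq v n n = ∏ j ∈ Finset.range (n + 1), v j := by
  induction n with
  | zero => simp [pSeq]
  | succ n ih =>
    have hn : (((n + 1 : ℕ) : ℤ) - 1) = (n : ℤ) := by push_cast; ring
    rw [pSeq_succ_natCast, hn, ih, Finset.prod_range_succ _ (n + 1)]
    simp [mul_comm]

theorem monotone_pSeq_zero {v : ℕ → ℝ} (hmono : Monotone v) (hv0 : ∀ k, 0 ≤ v k)
    (hv1 : ∀ k, v k ≤ 1) : Monotone fun n : ℕ => pSeq v n 0 :=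
  monotone_nat_of_le_succ fun n => pSeq_le_pSeq_succ hmono hv0 hv1 n (Int.natCast_nonneg n)

theorem one_sub_pSeq_zero_mul_sum_le {v : ℕ → ℝ} (hmono : Monotone v) (hv0 : ∀ k, 0 ≤ v k)
    (hv1 : ∀ k, v k ≤ 1) {n k : ℕ} (hkn : k ≤ n) :
    (1 - pSeq v n 0) * ∑ i ∈ Finset.range (k + 1), ∏ j ∈ Finset.range i, v j ≤
      1 - pSeq v n k := by
  induction k with
  | zero => simp
  | succ k ih =>
    have hsub := pSeq_pred_sub_pSeq v (n - (k + 1)) (k + 1)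
    have hk : (((k + 1 : ℕ) : ℤ) - 1) = (k : ℤ) := by push_cast; ring
    rw [Nat.sub_add_cancel hkn, hk] at hsub
    have hle : pSeq v (n - (k + 1)) 0 ≤ pSeq v n 0 :=
      monotone_pSeq_zero hmono hv0 hv1 (Nat.sub_le _ _)
    have hprod : 0 ≤ ∏ j ∈ Finset.range (k + 1), v j := Finset.prod_nonneg fun j _ => hv0 j
    rw [Finset.sum_range_succ]
    linarith [ih (by omega), mul_le_mul_of_nonneg_left hle hprod]

theorem div_one_add_le_pSeq_zero {v : ℕ → ℝ} (hmono : Monotone v) (hv0 : ∀ k, 0 ≤ v k)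
    (hv1 : ∀ k, v k ≤ 1) (n : ℕ) :
    (∑ k ∈ Finset.range (n + 1), ∏ j ∈ Finset.range (k + 1), v j) /
      (1 + ∑ k ∈ Finset.range (n + 1), ∏ j ∈ Finset.range (k + 1), v j) ≤ pSeq v n 0 := by
  have hprod : ∀ k, 0 ≤ ∏ j ∈ Finset.range k, v j := fun k => Finset.prod_nonneg fun j _ => hv0 j
  have hW : 0 ≤ ∑ k ∈ Finset.range (n + 1), ∏ j ∈ Finset.range (k + 1), v j :=
    Finset.sum_nonneg fun k _ => hprod (k + 1)
  have h := one_sub_pSeq_zero_mul_sum_le hmono hv0 hv1 (le_refl n)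
  have hsum : ∑ i ∈ Finset.range (n + 1), ∏ j ∈ Finset.range i, v j +
        ∏ j ∈ Finset.range (n + 1), v j =
      1 + ∑ k ∈ Finset.range (n + 1), ∏ j ∈ Finset.range (k + 1), v j := by
    rw [← Finset.sum_range_succ, Finset.sum_range_succ', Finset.prod_range_zero, add_comm]
  rw [pSeq_self, eq_sub_of_add_eq hsum] at h
  rw [div_le_iff₀ (by linarith)]
  nlinarith [mul_nonneg (pSeq_mem_Icc hmono hv0 hv1 n 0).1 (hprod (n + 1))]

/-- **Lemma 3.3.**  For the recursively defined `p_k^{(n)}`, the sequence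
`(p_0^{(n)})_n` is nondecreasing, its limit `p_0` exists and satisfies
`p_0 ≥ lim_n W_n/(1+W_n)` where `W_n = ∑_{k=0}^n ∏_{j=0}^k v_j`; in particular
`p_0 = 1` when `∑_k ∏_{j=0}^k v_j = ∞`. -/
theorem pSeq_limit_bound (v : ℕ → ℝ) (hmono : Monotone v)
    (hvpos : ∀ k, 0 < v k) (hvle : ∀ k, v k ≤ 1) :
    Monotone (fun n : ℕ => pSeq v n 0) ∧
    ∃ p0 : ℝ, Tendsto (fun n : ℕ => pSeq v n 0) atTop (nhds p0) ∧
      (⨆ n : ℕ,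
        (∑ k ∈ Finset.range (n + 1), ∏ j ∈ Finset.range (k + 1), v j) /
          (1 + ∑ k ∈ Finset.range (n + 1), ∏ j ∈ Finset.range (k + 1), v j)) ≤ p0 ∧
      (Tendsto (fun n : ℕ => ∑ k ∈ Finset.range (n + 1), ∏ j ∈ Finset.range (k + 1), v j)
          atTop atTop → p0 = 1) := by
  have hv0 : ∀ k, 0 ≤ v k := fun k => (hvpos k).le
  have hm := monotone_pSeq_zero hmono hv0 hvle
  have hle : ∀ n, pSeq v n 0 ≤ 1 := fun n => (pSeq_mem_Icc hmono hv0 hvle n 0).2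
  have hlim := tendsto_atTop_ciSup hm ⟨1, by rintro _ ⟨n, rfl⟩; exact hle n⟩
  have hbound := fun n =>
    (div_one_add_le_pSeq_zero hmono hv0 hvle n).trans (hm.ge_of_tendsto hlim n)
  refine ⟨hm, _, hlim, ciSup_le hbound, fun hW => ?_⟩
  refine le_antisymm (ciSup_le hle) ?_
  have hone : Tendsto (fun x : ℝ => x / (1 + x)) atTop (nhds 1) := by
    have h : Tendsto (fun x : ℝ => 1 - (1 + x)⁻¹) atTop (nhds (1 - 0)) :=
      tendsto_const_nhds.sub (tendsto_inv_atTop_zero.comp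
        (tendsto_atTop_add_const_left _ 1 tendsto_id))
    rw [sub_zero] at h
    refine h.congr' ?_
    filter_upwards [eventually_ge_atTop 0] with x hx
    have : 1 + x ≠ 0 := by positivity
    field_simp
    ring
  exact le_of_tendsto' (hone.comp hW) hbound

end GibbsFormal
end
end

section
/- Let 𝒱 = {φ_Λ}_{Λ∈𝒞} be a positive, continuous, T-invariant specification on X = S^ℤ. Suppose that for every x ∈ X the limit g_𝒱(x) = lim_{n→∞} π^𝒱_{[0,n]}([x]_{{0}} | x) exists and defines a continuous function on X. Then g_𝒱 is strictly positive, ℬ_{ℤ⁻}-measurable, satisfies ∑_{s∈S} g_𝒱(s_0 x) = 1 for all x ∈ X (i.e. g_𝒱 ∈ 𝒢_X), and a probability measure μ on (X,ℬ) is a Gibbs state for 𝒱 if and only if μ is a g_𝒱-chain. -/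
open MeasureTheory Filter Set Asymptotics

noncomputable section

namespace GibbsFormal

variable {S : Type} [Fintype S] [Nonempty S] [DecidableEq S]
  [TopologicalSpace S] [DiscreteTopology S]
  [MeasurableSpace S] [MeasurableSingletonClass S]

set_option linter.unusedSectionVars false

/-! ### The averaging operators of a specification -/

/-- The expectation `∑_{y ∈ [x]_{Λᶜ}} φ_Λ(y) f(y)` of `f` under `π^𝒱_Λ(· | x)`. -/
def Specification.avg (V : Specification S) (Λ : Finset ℤ) (f : Conf S → ℝ) (x : Conf S) : ℝ :=
  ∑ ζ : Λ → S, V.φ Λ (ov x Λ ζ) * f (ov x Λ ζ)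

lemma ov_apply_mem (x : Conf S) {Λ : Finset ℤ} (ζ : Λ → S) {i : ℤ} (h : i ∈ Λ) :
    ov x Λ ζ i = ζ ⟨i, h⟩ := by
  simp [ov, h]

lemma ov_apply_notMem (x : Conf S) {Λ : Finset ℤ} (ζ : Λ → S) {i : ℤ} (h : i ∉ Λ) :
    ov x Λ ζ i = x i := by
  simp [ov, h]

lemma ov_congr {x y : Conf S} {Λ : Finset ℤ} (h : ∀ i ∉ Λ, x i = y i) (ζ : Λ → S) :
    ov x Λ ζ = ov y Λ ζ := by
  funext i
  by_cases hi : i ∈ Λ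
  · simp [ov, hi]
  · simp [ov, hi, h i hi]

lemma ov_restrict (x : Conf S) (Λ : Finset ℤ) : ov x Λ (fun i => x i) = x := by
  funext i
  by_cases hi : i ∈ Λ <;> simp [ov, hi]

lemma measurable_ov (Λ : Finset ℤ) (ζ : Λ → S) : Measurable fun x : Conf S => ov x Λ ζ := by
  refine measurable_pi_iff.2 fun i => ?_
  by_cases hi : i ∈ Λ
  · simp only [ov, hi, dite_true]
    exact measurable_const
  · simp only [ov, hi, dite_false]
    exact measurable_pi_apply i

lemma continuous_ov (Λ : Finset ℤ) (ζ : Λ → S) : Continuous fun x : Conf S => ov x Λ ζ := by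
  refine continuous_pi fun i => ?_
  by_cases hi : i ∈ Λ
  · simp only [ov, hi, dite_true]
    exact continuous_const
  · simp only [ov, hi, dite_false]
    exact continuous_apply i

lemma measurable_upd (s : S) (n : ℤ) : Measurable fun x : Conf S => upd s n x := by
  refine measurable_pi_iff.2 fun i => ?_
  by_cases hi : i = n
  · simp only [upd, hi, if_true]
    exact measurable_const
  · simp only [upd, hi, if_false]
    exact measurable_pi_apply i

lemma measurable_shift (n : ℤ) : Measurable fun x : Conf S => shift n x :=
  measurable_pi_iff.2 fun i => measurable_pi_apply (i + n)

namespace Specification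

variable (V : Specification S)

lemma avg_congr (Λ : Finset ℤ) (f : Conf S → ℝ) {x y : Conf S} (h : ∀ i ∉ Λ, x i = y i) :
    V.avg Λ f x = V.avg Λ f y := by
  simp only [avg, ov_congr h]

lemma avg_mul_of_forall_eq (Λ : Finset ℤ) (f h : Conf S → ℝ) (x : Conf S)
    (hh : ∀ ζ : Λ → S, h (ov x Λ ζ) = h x) :
    V.avg Λ (fun y => h y * f y) x = h x * V.avg Λ f x := by
  simp only [avg, hh, Finset.mul_sum]
  exact Finset.sum_congr rfl fun ζ _ => by ring

lemma avg_const (Λ : Finset ℤ) (c : ℝ) (x : Conf S) : V.avg Λ (fun _ => c) x = c := by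
  simp only [avg, ← Finset.sum_mul, V.sum_one, one_mul]

lemma avg_of_forall_eq (Λ : Finset ℤ) (f : Conf S → ℝ) (x : Conf S)
    (h : ∀ ζ : Λ → S, f (ov x Λ ζ) = f x) : V.avg Λ f x = f x := by
  rw [← V.avg_const Λ (f x) x]
  simp only [avg, h]

lemma abs_avg_sub_le (Λ : Finset ℤ) (f h : Conf S → ℝ) (x : Conf S) {ε : ℝ}
    (hf : ∀ y, |f y - h y| ≤ ε) : |V.avg Λ f x - V.avg Λ h x| ≤ ε := by
  have : V.avg Λ f x - V.avg Λ h x = V.avg Λ (fun y => f y - h y) x := by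
    simp only [avg, ← Finset.sum_sub_distrib, mul_sub]
  rw [this, ← V.avg_const Λ ε x]
  refine (Finset.abs_sum_le_sum_abs _ _).trans (Finset.sum_le_sum fun ζ _ => ?_)
  rw [abs_mul, abs_of_nonneg (V.nonneg _ _)]
  exact mul_le_mul_of_nonneg_left (hf _) (V.nonneg _ _)

lemma abs_avg_le (Λ : Finset ℤ) (f : Conf S → ℝ) (x : Conf S) {C : ℝ}
    (hf : ∀ y, |f y| ≤ C) : |V.avg Λ f x| ≤ C := by
  simpa [V.avg_const] using V.abs_avg_sub_le Λ f (fun _ => 0) x (by simpa using hf)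

lemma measurable_avg (Λ : Finset ℤ) {f : Conf S → ℝ} (hf : Measurable f) :
    Measurable (V.avg Λ f) :=
  Finset.measurable_sum _ fun ζ _ =>
    ((V.measurable Λ).comp (measurable_ov Λ ζ)).mul (hf.comp (measurable_ov Λ ζ))

lemma continuous_avg (hcont : V.IsCont) (Λ : Finset ℤ) {f : Conf S → ℝ} (hf : Continuous f) :
    Continuous (V.avg Λ f) :=
  continuous_finsetSum _ fun ζ _ =>
    ((hcont Λ).comp (continuous_ov Λ ζ)).mul (hf.comp (continuous_ov Λ ζ))

lemma avg_indicator_cylEvent (Λ : Finset ℤ) (h : Conf S → ℝ) (ζ : Λ → S) (x : Conf S) :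
    V.avg Λ (fun y => (cylEvent Λ ζ).indicator (fun _ => (1 : ℝ)) y * h y) x =
      V.φ Λ (ov x Λ ζ) * h (ov x Λ ζ) := by
  rw [avg, Finset.sum_eq_single ζ]
  · have : ov x Λ ζ ∈ cylEvent Λ ζ := fun i => ov_apply_mem x ζ i.2
    simp [this]
  · intro η _ hη
    have : ov x Λ η ∉ cylEvent Λ ζ := fun hmem =>
      hη (funext fun i => (ov_apply_mem x η i.2).symm.trans (hmem i))
    simp [this]
  · simp

/-- Resampling inside a smaller volume first does not change the average. -/
lemma avg_avg {K Λ : Finset ℤ} (hK : K ⊆ Λ) (f : Conf S → ℝ) (x : Conf S) :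
    V.avg Λ (V.avg K f) x = V.avg Λ f x := by
  have hl : V.avg Λ (V.avg K f) x = ∑ p : (Λ → S) × (K → S),
      V.φ Λ (ov x Λ p.1) * (V.φ K (ov (ov x Λ p.1) K p.2) * f (ov (ov x Λ p.1) K p.2)) := by
    simp only [avg, Finset.mul_sum, Fintype.sum_prod_type]
  have hr : V.avg Λ f x = ∑ p : (Λ → S) × (K → S),
      V.φ Λ (ov (ov x Λ p.1) K p.2) * (V.φ K (ov x Λ p.1) * f (ov x Λ p.1)) := by
    simp only [avg, Fintype.sum_prod_type]
    refine Finset.sum_congr rfl fun ζ _ => ?_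
    conv_lhs => rw [V.consistent K Λ hK]
    rw [← Finset.sum_mul]
    ring
  let e : (Λ → S) × (K → S) → (Λ → S) × (K → S) := fun p =>
    (fun i => ov (ov x Λ p.1) K p.2 i, fun i => p.1 ⟨i, hK i.2⟩)
  have h1 : ∀ p, ov x Λ (e p).1 = ov (ov x Λ p.1) K p.2 := by
    intro p
    funext i
    by_cases hi : i ∈ Λ
    · simp [e, ov, hi]
    · have hi' : i ∉ K := fun h => hi (hK h)
      simp [ov, hi, hi']
  have h2 : ∀ p, ov (ov x Λ (e p).1) K (e p).2 = ov x Λ p.1 := by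
    intro p
    rw [h1]
    funext i
    by_cases hi : i ∈ K
    · simp [e, ov, hi, hK hi]
    · simp [ov, hi]
  have he : Function.Involutive e := by
    intro p
    refine Prod.ext (funext fun i => ?_) (funext fun i => ?_)
    · change ov (ov x Λ (e p).1) K (e p).2 i = p.1 i
      rw [h2, ov_apply_mem x p.1 i.2]
    · change ov (ov x Λ p.1) K p.2 i = p.2 i
      rw [ov_apply_mem _ p.2 i.2]
  rw [hl, hr]
  refine Fintype.sum_equiv he.toPerm _ _ fun p => ?_
  change _ = V.φ Λ (ov (ov x Λ (e p).1) K (e p).2) *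
    (V.φ K (ov x Λ (e p).1) * f (ov x Λ (e p).1))
  rw [h2, h1]

/-- The averaging operators of an invariant specification commute with the shift. -/
lemma avg_image_add (hinv : V.TInvariant) (n : ℤ) (Λ : Finset ℤ) (f : Conf S → ℝ)
    (x : Conf S) :
    V.avg (Λ.image fun i => n + i) (fun y => f (shift n y)) x = V.avg Λ f (shift n x) := by
  let e : Λ ≃ (Λ.image fun i => n + i) :=
    { toFun := fun i => ⟨n + i, Finset.mem_image_of_mem _ i.2⟩
      invFun := fun j => ⟨j - n, by
        obtain ⟨i, hi, h⟩ := Finset.mem_image.1 j.2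
        rw [← h, add_sub_cancel_left]
        exact hi⟩
      left_inv := fun i => by simp
      right_inv := fun j => by simp }
  refine Fintype.sum_equiv (Equiv.arrowCongr e.symm (Equiv.refl S)) _ _ fun ζ => ?_
  have : shift n (ov x (Λ.image fun i => n + i) ζ) =
      ov (shift n x) Λ (Equiv.arrowCongr e.symm (Equiv.refl S) ζ) := by
    funext i
    by_cases hi : i ∈ Λ
    · have hi' : i + n ∈ Λ.image fun i => n + i :=
        Finset.mem_image.2 ⟨i, hi, add_comm _ _⟩
      rw [ov_apply_mem _ _ hi, shift, ov_apply_mem _ _ hi']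
      simp [e, add_comm]
    · have hi' : i + n ∉ Λ.image fun i => n + i := by
        intro h
        obtain ⟨j, hj, h⟩ := Finset.mem_image.1 h
        exact hi (by rwa [← (by linarith : j = i)])
      rw [ov_apply_notMem _ _ hi, shift, ov_apply_notMem _ _ hi', shift]
  simp only [hinv n Λ, this]

end Specification

/-! ### Functions of finitely or infinitely many coordinates -/

lemma cylSA_le (s : Set ℤ) : (cylSA s : MeasurableSpace (Conf S)) ≤ MeasurableSpace.pi :=
  Measurable.comap_le (measurable_pi_iff.2 fun i => measurable_pi_apply (i : ℤ))

lemma borelSpace_conf : BorelSpace (Conf S) := by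
  have : BorelSpace S := ⟨by
    rw [borel_eq_top_of_discrete]
    exact top_unique fun s _ => s.toFinite.measurableSet⟩
  infer_instance

lemma measurable_cylSA_of_dependsOn {f : Conf S → ℝ} (hf : Measurable f) {s : Set ℤ}
    (h : DependsOn f s) : Measurable[cylSA s] f := by
  classical
  let r : Conf S → Conf S := fun x i => if i ∈ s then x i else Classical.arbitrary S
  have hr : Measurable[cylSA s] r := by
    refine (@measurable_pi_iff _ _ _ (cylSA s) _ _).2 fun i => ?_
    by_cases hi : i ∈ s
    · simp only [r, hi, if_true]
      exact Measurable.comp (g := fun z : s → S => z ⟨i, hi⟩) (measurable_pi_apply _)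
        (comap_measurable fun x : Conf S => s.domRestrict x)
    · simp only [r, hi, if_false]
      exact measurable_const
  have : f = f ∘ r := funext fun x => h fun i hi => by simp [r, hi]
  rw [this]
  exact hf.comp hr

lemma dependsOn_indicator_of_measurableSet_cylSA {A : Set (Conf S)} {s : Set ℤ}
    (hA : MeasurableSet[cylSA s] A) : DependsOn (A.indicator fun _ => (1 : ℝ)) s := by
  obtain ⟨B, -, rfl⟩ := hA
  intro x y hxy
  have : s.domRestrict x = s.domRestrict y := funext fun i => hxy i i.2
  change B.indicator (fun _ => (1 : ℝ)) (s.domRestrict x) =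
    B.indicator (fun _ => (1 : ℝ)) (s.domRestrict y)
  rw [this]

lemma dependsOn_comp_ov (Λ : Finset ℤ) (ζ : Λ → S) (f : Conf S → ℝ) :
    DependsOn (fun x => f (ov x Λ ζ)) ((Λ : Set ℤ)ᶜ) := by
  intro x y hxy
  simp only [ov_congr (fun i hi => hxy i (by simpa using hi)) ζ]

lemma abs_indicator_one_le {α : Type*} (A : Set α) (x : α) :
    |A.indicator (fun _ => (1 : ℝ)) x| ≤ 1 := by
  by_cases hx : x ∈ A <;> simp [hx]

lemma integrable_of_abs_le {α : Type*} [MeasurableSpace α] {μ : Measure α} [IsFiniteMeasure μ]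
    {f : α → ℝ} (hf : Measurable f) {C : ℝ} (hC : ∀ x, |f x| ≤ C) : Integrable f μ :=
  Integrable.of_bound hf.aestronglyMeasurable C (ae_of_all _ hC)

lemma integral_mul_eq_of_ae_eq_condExp {α : Type*} {m m₀ : MeasurableSpace α} (hm : m ≤ m₀)
    {μ : Measure α} [IsFiniteMeasure μ] {F u h : α → ℝ} (hF : F =ᵐ[μ] μ[u | m])
    (hu : Measurable u) {C : ℝ} (huC : ∀ x, |u x| ≤ C)
    (hh : Measurable[m] h) {D : ℝ} (hhD : ∀ x, |h x| ≤ D) :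
    ∫ x, F x * h x ∂μ = ∫ x, u x * h x ∂μ := by
  have hhu : Integrable (h * u) μ := by
    refine integrable_of_abs_le ((hh.mono hm le_rfl).mul hu) (C := D * C) fun x => ?_
    rw [Pi.mul_apply, abs_mul]
    exact mul_le_mul (hhD x) (huC x) (abs_nonneg _) ((abs_nonneg _).trans (hhD x))
  have h1 := condExp_mul_of_stronglyMeasurable_left hh.stronglyMeasurable hhu
    (integrable_of_abs_le hu huC)
  calc ∫ x, F x * h x ∂μ = ∫ x, (μ[h * u | m]) x ∂μ := by
        refine integral_congr_ae ?_
        filter_upwards [hF, h1] with x hx1 hx2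
        rw [hx1, hx2, Pi.mul_apply, mul_comm]
    _ = ∫ x, u x * h x ∂μ := by
        rw [integral_condExp hm]
        simp only [Pi.mul_apply, mul_comm]

lemma ae_eq_condExp_of_forall_integral_mul_indicator {α : Type*} {m m₀ : MeasurableSpace α}
    (hm : m ≤ m₀) {μ : Measure α} [IsFiniteMeasure μ] {F u : α → ℝ} (hF : Measurable[m] F)
    {D : ℝ} (hFD : ∀ x, |F x| ≤ D) (hu : Measurable u) {C : ℝ} (huC : ∀ x, |u x| ≤ C)
    (h : ∀ A, MeasurableSet[m] A → ∫ x, F x * A.indicator (fun _ => (1 : ℝ)) x ∂μ =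
      ∫ x, u x * A.indicator (fun _ => (1 : ℝ)) x ∂μ) :
    F =ᵐ[μ] μ[u | m] := by
  refine ae_eq_condExp_of_forall_setIntegral_eq hm (integrable_of_abs_le hu huC)
    (fun A _ _ => (integrable_of_abs_le (hF.mono hm le_rfl) hFD).integrableOn)
    (fun A hA _ => ?_) hF.stronglyMeasurable.aestronglyMeasurable
  have key : ∀ v : α → ℝ, ∫ x in A, v x ∂μ =
      ∫ x, v x * A.indicator (fun _ => (1 : ℝ)) x ∂μ := by
    intro v
    rw [← integral_indicator (hm A hA)]
    refine integral_congr_ae (ae_of_all _ fun x => ?_)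
    by_cases hx : x ∈ A <;> simp [hx]
  rw [key, key, h A hA]

/-! ### The DLR equations in integrated form -/

lemma measurableSet_cylEvent (Λ : Finset ℤ) (ζ : Λ → S) : MeasurableSet (cylEvent Λ ζ) := by
  have : cylEvent Λ ζ = ⋂ i : Λ, (fun y : Conf S => y i) ⁻¹' {ζ i} := by
    ext y
    simp [cylEvent]
  rw [this]
  exact MeasurableSet.iInter fun i => measurable_pi_apply (i : ℤ) (measurableSet_singleton _)

lemma measurable_indicator_cylEvent (Λ : Finset ℤ) (ζ : Λ → S) :
    Measurable ((cylEvent Λ ζ).indicator fun _ => (1 : ℝ)) :=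
  measurable_const.indicator (measurableSet_cylEvent Λ ζ)

lemma sum_indicator_cylEvent_mul (Λ : Finset ℤ) (f : Conf S → ℝ) (x : Conf S) :
    ∑ ζ : Λ → S, (cylEvent Λ ζ).indicator (fun _ => (1 : ℝ)) x * f (ov x Λ ζ) = f x := by
  rw [Finset.sum_eq_single fun i : Λ => x i]
  · have : x ∈ cylEvent Λ fun i : Λ => x i := fun i => rfl
    rw [ov_restrict]
    simp [this]
  · intro η _ hη
    have : x ∉ cylEvent Λ η := fun hmem => hη (funext fun i => (hmem i).symm)
    simp [this]
  · simp

lemma Specification.abs_phi_le_one (V : Specification S) (Λ : Finset ℤ) (x : Conf S) :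
    |V.φ Λ x| ≤ 1 := by
  rw [abs_of_nonneg (V.nonneg Λ x), ← V.sum_one Λ x]
  conv_lhs => rw [← ov_restrict x Λ]
  exact Finset.single_le_sum (f := fun ζ : Λ → S => V.φ Λ (ov x Λ ζ))
    (fun ζ _ => V.nonneg Λ _) (Finset.mem_univ _)

lemma GibbsCond.integral_avg {V : Specification S} {μ : Measure (Conf S)}
    [IsProbabilityMeasure μ] (hμ : GibbsCond V.φ μ) {Λ : Finset ℤ} (hΛ : Λ.Nonempty)
    {f : Conf S → ℝ} (hf : Measurable f) {C : ℝ} (hC : ∀ x, |f x| ≤ C) :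
    ∫ x, V.avg Λ f x ∂μ = ∫ x, f x ∂μ := by
  have hC0 : 0 ≤ C := (abs_nonneg _).trans (hC (Classical.arbitrary _))
  have hfo : ∀ ζ : Λ → S, Measurable fun x => f (ov x Λ ζ) := fun ζ =>
    hf.comp (measurable_ov Λ ζ)
  have hint : ∀ (u : Conf S → ℝ), Measurable u → (∀ x, |u x| ≤ 1) → ∀ ζ : Λ → S,
      Integrable (fun x => u x * f (ov x Λ ζ)) μ := by
    intro u hu hu1 ζ
    refine integrable_of_abs_le (C := 1 * C) (hu.mul (hfo ζ)) fun x => ?_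
    rw [abs_mul]
    exact mul_le_mul (hu1 x) (hC _) (abs_nonneg _) zero_le_one
  calc ∫ x, V.avg Λ f x ∂μ
      = ∑ ζ : Λ → S, ∫ x, V.φ Λ (ov x Λ ζ) * f (ov x Λ ζ) ∂μ :=
        integral_finsetSum _ fun ζ _ => hint _ ((V.measurable Λ).comp (measurable_ov Λ ζ))
          (fun x => V.abs_phi_le_one Λ _) ζ
    _ = ∑ ζ : Λ → S,
          ∫ x, (cylEvent Λ ζ).indicator (fun _ => (1 : ℝ)) x * f (ov x Λ ζ) ∂μ :=
        Finset.sum_congr rfl fun ζ _ => integral_mul_eq_of_ae_eq_condExp (cylSA_le _)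
          (hμ Λ hΛ ζ) (measurable_indicator_cylEvent Λ ζ) (abs_indicator_one_le _)
          (measurable_cylSA_of_dependsOn (hfo ζ) (dependsOn_comp_ov Λ ζ f)) fun x => hC _
    _ = ∫ x, f x ∂μ := by
        rw [← integral_finsetSum _ fun ζ _ => hint _ (measurable_indicator_cylEvent Λ ζ)
          (abs_indicator_one_le _) ζ]
        simp only [sum_indicator_cylEvent_mul]

lemma gibbsCond_of_integral_avg (V : Specification S) (μ : Measure (Conf S))
    [IsProbabilityMeasure μ]
    (h : ∀ (Λ : Finset ℤ) (f : Conf S → ℝ), Measurable f → (∀ x, |f x| ≤ 1) →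
      ∫ x, V.avg Λ f x ∂μ = ∫ x, f x ∂μ) :
    GibbsCond V.φ μ := by
  intro Λ _ ζ
  refine ae_eq_condExp_of_forall_integral_mul_indicator (cylSA_le _)
    (measurable_cylSA_of_dependsOn ((V.measurable Λ).comp (measurable_ov Λ ζ))
      (dependsOn_comp_ov Λ ζ _)) (fun x => V.abs_phi_le_one Λ _)
    (measurable_indicator_cylEvent Λ ζ) (abs_indicator_one_le _) fun A hA => ?_
  have hA' : Measurable (A.indicator fun _ => (1 : ℝ)) :=
    measurable_const.indicator (cylSA_le _ A hA)
  have hΛ := h Λ (fun y => (cylEvent Λ ζ).indicator (fun _ => (1 : ℝ)) y *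
    A.indicator (fun _ => 1) y) ((measurable_indicator_cylEvent Λ ζ).mul hA') fun x => ?_
  rw [← hΛ]
  · refine integral_congr_ae (ae_of_all _ fun x => ?_)
    have hov : A.indicator (fun _ => (1 : ℝ)) (ov x Λ ζ) = A.indicator (fun _ => 1) x :=
      dependsOn_indicator_of_measurableSet_cylSA hA fun i hi =>
        ov_apply_notMem x ζ (by simpa using hi)
    exact (hov ▸ V.avg_indicator_cylEvent Λ (A.indicator fun _ => (1 : ℝ)) ζ x).symm
  · rw [abs_mul]
    exact mul_le_one₀ (abs_indicator_one_le _ _) (abs_nonneg _) (abs_indicator_one_le _ _)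

/-- Invariance under the averaging operators only has to be tested on continuous functions. -/
lemma integral_avg_of_continuous (V : Specification S) (μ : Measure (Conf S))
    [IsProbabilityMeasure μ] (Λ : Finset ℤ)
    (h : ∀ f : Conf S → ℝ, Continuous f → ∫ x, V.avg Λ f x ∂μ = ∫ x, f x ∂μ)
    {f : Conf S → ℝ} (hf : Measurable f) {C : ℝ} (hC : ∀ x, |f x| ≤ C) :
    ∫ x, V.avg Λ f x ∂μ = ∫ x, f x ∂μ := by
  have hφ : ∀ ζ : Λ → S, Measurable fun x => V.φ Λ (ov x Λ ζ) := fun ζ =>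
    (V.measurable Λ).comp (measurable_ov Λ ζ)
  let ν : Measure (Conf S) := ∑ ζ : Λ → S,
    (μ.withDensity fun x => ENNReal.ofReal (V.φ Λ (ov x Λ ζ))).map fun x => ov x Λ ζ
  have hfin : ∀ ζ : Λ → S,
      IsFiniteMeasure (μ.withDensity fun x => ENNReal.ofReal (V.φ Λ (ov x Λ ζ))) := fun ζ =>
    isFiniteMeasure_withDensity_ofReal
      (integrable_of_abs_le (hφ ζ) fun x => V.abs_phi_le_one Λ _).2
  have hν : IsFiniteMeasure ν := by
    refine ⟨?_⟩
    simp only [ν, Measure.coe_finsetSum, Finset.sum_apply]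
    exact ENNReal.sum_lt_top.2 fun ζ _ => measure_lt_top _ _
  have key : ∀ u : Conf S → ℝ, Measurable u → ∀ D, (∀ x, |u x| ≤ D) →
      ∫ x, u x ∂ν = ∫ x, V.avg Λ u x ∂μ := by
    intro u hu D hD
    rw [integral_finsetSum_measure fun ζ _ => integrable_of_abs_le hu hD]
    simp only [Specification.avg]
    rw [integral_finsetSum]
    · refine Finset.sum_congr rfl fun ζ _ => ?_
      rw [integral_map (measurable_ov Λ ζ).aemeasurable hu.aestronglyMeasurable,
        integral_withDensity_eq_integral_toReal_smul (hφ ζ).ennreal_ofReal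
          (ae_of_all _ fun _ => ENNReal.ofReal_lt_top)]
      simp only [ENNReal.toReal_ofReal (V.nonneg _ _), smul_eq_mul]
    · intro ζ _
      refine integrable_of_abs_le (C := 1 * D) ((hφ ζ).mul (hu.comp (measurable_ov Λ ζ)))
        fun x => ?_
      rw [abs_mul]
      exact mul_le_mul (V.abs_phi_le_one Λ _) (hD _) (abs_nonneg _) zero_le_one
  have := borelSpace_conf (S := S)
  have hνμ : ν = μ := by
    refine ext_of_forall_integral_eq_of_IsFiniteMeasure fun u => ?_
    rw [key u u.continuous.measurable ‖u‖ u.norm_coe_le_norm, h u u.continuous]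
  rw [← key f hf C hC, hνμ]

/-! ### The limit function -/

lemma upd_self (n : ℤ) (x : Conf S) : upd (x n) n x = x := by
  funext i
  by_cases hi : i = n <;> simp [upd, hi]

lemma piG_eq_avg (V : Specification S) (n : ℕ) (x : Conf S) :
    piG V n x = V.avg (Finset.Icc 0 (n : ℤ)) (fun y => if y 0 = x 0 then 1 else 0) x := rfl

section Limit

variable {V : Specification S} {g : Conf S → ℝ}

lemma abs_limit_le_one
    (hg : ∀ x : Conf S, Tendsto (fun n : ℕ => piG V n x) atTop (nhds (g x))) (x : Conf S) :
    |g x| ≤ 1 := by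
  refine le_of_tendsto (hg x).abs (Eventually.of_forall fun n => ?_)
  rw [piG_eq_avg]
  exact V.abs_avg_le _ _ x fun y => by split_ifs <;> simp

lemma limit_eq_of_forall_notMem_Icc
    (hg : ∀ x : Conf S, Tendsto (fun n : ℕ => piG V n x) atTop (nhds (g x)))
    {x y : Conf S} {N : ℤ} (h : ∀ i ∉ Finset.Icc 1 N, x i = y i) : g x = g y := by
  refine tendsto_nhds_unique_of_eventuallyEq (hg x) (hg y) ?_
  filter_upwards [eventually_ge_atTop N.toNat] with n hn
  have h0 : x 0 = y 0 := h 0 (by simp)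
  rw [piG_eq_avg, piG_eq_avg, h0]
  refine V.avg_congr _ _ fun i hi => h i fun hi' => hi ?_
  rw [Finset.mem_Icc] at hi' ⊢
  omega

lemma dependsOn_limit
    (hg : ∀ x : Conf S, Tendsto (fun n : ℕ => piG V n x) atTop (nhds (g x)))
    (hgcont : Continuous g) : DependsOn g (Set.Iic (0 : ℤ)) := by
  intro x y hxy
  let w : ℕ → Conf S := fun n i => if i ≤ n then x i else y i
  have hw : Tendsto w atTop (nhds x) := by
    refine tendsto_pi_nhds.2 fun i => tendsto_const_nhds.congr' ?_
    filter_upwards [eventually_ge_atTop i.toNat] with n hn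
    have : i ≤ n := by omega
    simp [w, this]
  have hgw : ∀ n, g (w n) = g y := fun n =>
    limit_eq_of_forall_notMem_Icc hg (N := n) fun i hi => by
      by_cases hin : i ≤ n
      · have : i ≤ 0 := by
          rw [Finset.mem_Icc] at hi
          omega
        simp [w, hin, hxy i this]
      · simp [w, hin]
  refine tendsto_nhds_unique ((hgcont.tendsto x).comp hw) ?_
  exact tendsto_const_nhds.congr fun n => (hgw n).symm

lemma sum_limit_upd
    (hg : ∀ x : Conf S, Tendsto (fun n : ℕ => piG V n x) atTop (nhds (g x))) (x : Conf S) :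
    ∑ s : S, g (upd s 0 x) = 1 := by
  refine tendsto_nhds_unique (tendsto_finsetSum _ fun s _ => hg (upd s 0 x)) ?_
  refine tendsto_const_nhds.congr fun n => ?_
  have h : ∀ s : S, piG V n (upd s 0 x) =
      V.avg (Finset.Icc 0 (n : ℤ)) (fun y => if y 0 = s then 1 else 0) x := by
    intro s
    rw [piG_eq_avg]
    have : upd s 0 x 0 = s := by simp [upd]
    rw [this]
    refine V.avg_congr _ _ fun i hi => ?_
    have : i ≠ 0 := by
      rintro rfl
      simp at hi
    simp [upd, this]
  simp only [h, Specification.avg]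
  rw [Finset.sum_comm]
  simp [V.sum_one]

lemma limit_pos (hpos : V.Positive) (hcont : V.IsCont)
    (hg : ∀ x : Conf S, Tendsto (fun n : ℕ => piG V n x) atTop (nhds (g x))) (x : Conf S) :
    0 < g x := by
  obtain ⟨z, -, hz⟩ := isCompact_univ.exists_isMinOn (Set.univ_nonempty (α := Conf S))
    (hcont {0}).continuousOn
  refine (hpos {0} z).trans_le (ge_of_tendsto (hg x) (Eventually.of_forall fun n => ?_))
  have h0 : ({0} : Finset ℤ) ⊆ Finset.Icc 0 (n : ℤ) := by simp
  rw [piG_eq_avg, ← V.avg_avg h0, ← V.avg_const (Finset.Icc 0 (n : ℤ)) (V.φ {0} z) x]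
  refine Finset.sum_le_sum fun ζ _ => mul_le_mul_of_nonneg_left ?_ (V.nonneg _ _)
  generalize ov x (Finset.Icc 0 (n : ℤ)) ζ = y
  refine le_trans ?_ (Finset.single_le_sum (fun η _ => mul_nonneg (V.nonneg _ _) ?_)
    (Finset.mem_univ fun _ : ({0} : Finset ℤ) => x 0))
  · have : ov y {0} (fun _ : ({0} : Finset ℤ) => x 0) 0 = x 0 := by simp [ov]
    simp only [if_pos this, mul_one]
    exact hz (Set.mem_univ _)
  · beta_reduce
    split_ifs <;> norm_num

lemma tendsto_avg_Icc (hinv : V.TInvariant)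
    (hg : ∀ x : Conf S, Tendsto (fun n : ℕ => piG V n x) atTop (nhds (g x)))
    (m : ℤ) (s : S) (x : Conf S) :
    Tendsto (fun N : ℤ => V.avg (Finset.Icc m N) (fun y => if y m = s then 1 else 0) x) atTop
      (nhds (g (shift m (upd s m x)))) := by
  have hN : Tendsto (fun N : ℤ => (N - m).toNat) atTop atTop :=
    tendsto_atTop.2 fun b => by
      filter_upwards [eventually_ge_atTop (m + b)] with N hN
      omega
  refine ((hg (shift m (upd s m x))).comp hN).congr' ?_
  filter_upwards [eventually_ge_atTop m] with N hmN
  have hI : (Finset.Icc 0 (((N - m).toNat : ℕ) : ℤ)).image (fun i => m + i) =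
      Finset.Icc m N := by
    rw [Finset.image_add_left_Icc]
    congr 1 <;> omega
  have hs : shift m (upd s m x) 0 = s := by simp [shift, upd]
  rw [Function.comp_apply, piG_eq_avg, ← V.avg_image_add hinv, hI, hs]
  simp only [shift, zero_add]
  refine V.avg_congr _ _ fun i hi => ?_
  have : i ≠ m := by
    rintro rfl
    exact hi (Finset.mem_Icc.2 ⟨le_rfl, hmN⟩)
  simp [upd, this]

end Limit

/-! ### Gibbs states are chains -/

section Chains

variable {V : Specification S} {g : Conf S → ℝ} {μ : Measure (Conf S)}

lemma dependsOn_shift_upd (hg : DependsOn g (Set.Iic (0 : ℤ))) (n : ℤ) (s : S) :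
    DependsOn (fun x => g (shift n (upd s n x))) (Set.Iic (n - 1)) := by
  intro x y hxy
  refine hg fun i hi => ?_
  by_cases h : i + n = n
  · simp [shift, upd, h]
  · simp only [shift, upd, h, if_false]
    refine hxy _ ?_
    simp only [Set.mem_Iic] at hi ⊢
    omega

lemma measurable_ite_eq (n : ℤ) (s : S) :
    Measurable fun x : Conf S => if x n = s then (1 : ℝ) else 0 :=
  Measurable.ite (measurableSet_eq_fun (measurable_pi_apply n) measurable_const) measurable_const
    measurable_const

lemma indicator_eq_ite (n : ℤ) (s : S) :
    ({y : Conf S | y n = s}).indicator (fun _ => (1 : ℝ)) =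
      fun x => if x n = s then 1 else 0 := by
  funext x
  by_cases h : x n = s <;> simp [h]

lemma abs_ite_le_one (p : Prop) [Decidable p] : |if p then (1 : ℝ) else 0| ≤ 1 := by
  split_ifs <;> simp

lemma GibbsCond.isGChain [IsProbabilityMeasure μ] (hμ : GibbsCond V.φ μ)
    (hinv : V.TInvariant)
    (hg : ∀ x : Conf S, Tendsto (fun n : ℕ => piG V n x) atTop (nhds (g x)))
    (hgm : Measurable g) (hgd : DependsOn g (Set.Iic (0 : ℤ))) : IsGChain g μ := by
  refine ⟨inferInstance, fun n s => ?_⟩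
  have hF : Measurable fun x => g (shift n (upd s n x)) :=
    hgm.comp ((measurable_shift n).comp (measurable_upd s n))
  rw [indicator_eq_ite]
  refine ae_eq_condExp_of_forall_integral_mul_indicator (cylSA_le _)
    (measurable_cylSA_of_dependsOn hF (dependsOn_shift_upd hgd n s))
    (fun x => abs_limit_le_one hg _) (measurable_ite_eq n s) (fun x => abs_ite_le_one _)
    fun A hA => ?_
  have hA1 : Measurable (A.indicator fun _ => (1 : ℝ)) :=
    measurable_const.indicator (cylSA_le _ A hA)
  let f : Conf S → ℝ := fun x => A.indicator (fun _ => (1 : ℝ)) x * if x n = s then 1 else 0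
  have hf : Measurable f := hA1.mul (measurable_ite_eq n s)
  have hf1 : ∀ x, |f x| ≤ 1 := fun x => by
    rw [abs_mul]
    exact mul_le_one₀ (abs_indicator_one_le _ _) (abs_nonneg _) (abs_ite_le_one _)
  have hlim : Tendsto (fun N : ℤ => ∫ x, V.avg (Finset.Icc n N) f x ∂μ) atTop
      (nhds (∫ x, g (shift n (upd s n x)) * A.indicator (fun _ => (1 : ℝ)) x ∂μ)) := by
    refine tendsto_integral_filter_of_dominated_convergence (fun _ => 1)
      (Eventually.of_forall fun N => (V.measurable_avg _ hf).aestronglyMeasurable)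
      (Eventually.of_forall fun N => ae_of_all _ fun x => V.abs_avg_le _ _ _ hf1)
      (integrable_const _) (ae_of_all _ fun x => ?_)
    rw [mul_comm]
    refine ((tendsto_avg_Icc hinv hg n s x).const_mul _).congr fun N => ?_
    refine (V.avg_mul_of_forall_eq _ _ _ x fun ζ => ?_).symm
    refine dependsOn_indicator_of_measurableSet_cylSA hA fun i hi => ov_apply_notMem x ζ ?_
    simp only [Set.mem_Iic] at hi
    simp only [Finset.mem_Icc]
    omega
  refine (tendsto_nhds_unique hlim ?_).trans
    (integral_congr_ae (ae_of_all _ fun x => mul_comm _ _))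
  refine tendsto_const_nhds.congr' ?_
  filter_upwards [eventually_ge_atTop n] with N hN
  exact (hμ.integral_avg (Finset.nonempty_Icc.2 hN) hf hf1).symm

/-! ### Chains are Gibbs states -/

/-- One step of the chain: integrate out the symbol at site `n`. -/
def chainStep (g : Conf S → ℝ) (n : ℤ) (h : Conf S → ℝ) (x : Conf S) : ℝ :=
  ∑ s : S, g (shift n (upd s n x)) * h (upd s n x)

lemma measurable_chainStep (hgm : Measurable g) (n : ℤ) {h : Conf S → ℝ} (hh : Measurable h) :
    Measurable (chainStep g n h) :=
  Finset.measurable_sum _ fun s _ =>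
    (hgm.comp ((measurable_shift n).comp (measurable_upd s n))).mul
      (hh.comp (measurable_upd s n))

lemma dependsOn_upd {n : ℤ} {h : Conf S → ℝ} (hh : DependsOn h (Set.Iic n)) (s : S) :
    DependsOn (fun x => h (upd s n x)) (Set.Iic (n - 1)) := by
  intro x y hxy
  refine hh fun i hi => ?_
  by_cases hin : i = n
  · simp [upd, hin]
  · simp only [upd, hin, if_false]
    refine hxy i ?_
    simp only [Set.mem_Iic] at hi ⊢
    omega

lemma dependsOn_chainStep (hgd : DependsOn g (Set.Iic (0 : ℤ))) {n : ℤ} {h : Conf S → ℝ}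
    (hh : DependsOn h (Set.Iic n)) : DependsOn (chainStep g n h) (Set.Iic (n - 1)) := by
  intro x y hxy
  refine Finset.sum_congr rfl fun s _ => ?_
  exact congr_arg₂ _ (dependsOn_shift_upd hgd n s hxy) (dependsOn_upd hh s hxy)

lemma integral_chainStep (hμ : IsGChain g μ) (hgm : Measurable g) (hg1 : ∀ x, |g x| ≤ 1)
    {n : ℤ} {h : Conf S → ℝ} (hh : Measurable h) (hd : DependsOn h (Set.Iic n))
    {C : ℝ} (hC : ∀ x, |h x| ≤ C) : ∫ x, chainStep g n h x ∂μ = ∫ x, h x ∂μ := by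
  have := hμ.1
  have hint : ∀ u : Conf S → ℝ, Measurable u → (∀ x, |u x| ≤ 1) → ∀ s,
      Integrable (fun x => u x * h (upd s n x)) μ := by
    intro u hu hu1 s
    refine integrable_of_abs_le (C := 1 * C) (hu.mul (hh.comp (measurable_upd s n)))
      fun x => ?_
    rw [abs_mul]
    exact mul_le_mul (hu1 x) (hC _) (abs_nonneg _) zero_le_one
  calc ∫ x, chainStep g n h x ∂μ
      = ∑ s : S, ∫ x, g (shift n (upd s n x)) * h (upd s n x) ∂μ :=
        integral_finsetSum _ fun s _ => hint _
          (hgm.comp ((measurable_shift n).comp (measurable_upd s n))) (fun x => hg1 _) s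
    _ = ∑ s : S, ∫ x, (if x n = s then 1 else 0) * h (upd s n x) ∂μ := by
        refine Finset.sum_congr rfl fun s _ => ?_
        have hs := hμ.2 n s
        rw [indicator_eq_ite] at hs
        exact integral_mul_eq_of_ae_eq_condExp (cylSA_le _) hs (measurable_ite_eq n s)
          (fun x => abs_ite_le_one _)
          (measurable_cylSA_of_dependsOn (hh.comp (measurable_upd s n)) (dependsOn_upd hd s))
          fun x => hC _
    _ = ∫ x, h x ∂μ := by
        rw [← integral_finsetSum _ fun s _ => hint _ (measurable_ite_eq n s)
          (fun x => abs_ite_le_one _) s]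
        simp [upd_self]

/-- If the averages over `[m+1, N]` converge pointwise, so do those over `[m, N]`. -/
lemma tendsto_avg_Icc_chainStep (hinv : V.TInvariant)
    (hg : ∀ x : Conf S, Tendsto (fun n : ℕ => piG V n x) atTop (nhds (g x)))
    {m : ℤ} {f h : Conf S → ℝ}
    (hf : ∀ x, Tendsto (fun N : ℤ => V.avg (Finset.Icc (m + 1) N) f x) atTop (nhds (h x)))
    (x : Conf S) :
    Tendsto (fun N : ℤ => V.avg (Finset.Icc m N) f x) atTop (nhds (chainStep g m h x)) := by
  refine (tendsto_finsetSum _ fun s _ =>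
    (tendsto_avg_Icc hinv hg m s x).mul (hf (upd s m x))).congr fun N => ?_
  have hsub : Finset.Icc (m + 1) N ⊆ Finset.Icc m N :=
    Finset.Icc_subset_Icc_left (by omega)
  rw [← V.avg_avg hsub]
  simp only [Specification.avg, Finset.sum_mul]
  rw [Finset.sum_comm]
  refine Finset.sum_congr rfl fun ζ _ => ?_
  have hy : ∀ η, ov (upd (ov x (Finset.Icc m N) ζ m) m x) (Finset.Icc (m + 1) N) η =
      ov (ov x (Finset.Icc m N) ζ) (Finset.Icc (m + 1) N) η := by
    refine ov_congr fun i hi => ?_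
    by_cases him : i = m
    · simp [upd, him]
    · have : i ∉ Finset.Icc m N := by
        rw [Finset.mem_Icc] at hi ⊢
        omega
      simp [upd, him, ov_apply_notMem x ζ this]
  simp only [mul_ite, mul_one, mul_zero, ite_mul, zero_mul, Finset.sum_ite_eq,
    Finset.mem_univ, if_true, hy]

lemma IsGChain.exists_tendsto_avg (hμ : IsGChain g μ) (hinv : V.TInvariant)
    (hg : ∀ x : Conf S, Tendsto (fun n : ℕ => piG V n x) atTop (nhds (g x)))
    (hgm : Measurable g) (hgd : DependsOn g (Set.Iic (0 : ℤ)))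
    {n : ℤ} {f : Conf S → ℝ} (hf : Measurable f) (hfd : DependsOn f (Set.Iic n))
    {C : ℝ} (hC : ∀ x, |f x| ≤ C) (k : ℕ) :
    ∃ h : Conf S → ℝ,
      (∀ x, Tendsto (fun N : ℤ => V.avg (Finset.Icc (n + 1 - k) N) f x) atTop (nhds (h x))) ∧
      Measurable h ∧ DependsOn h (Set.Iic (n - k)) ∧ ∫ x, h x ∂μ = ∫ x, f x ∂μ := by
  induction k with
  | zero =>
    refine ⟨f, fun x => tendsto_const_nhds.congr fun N => ?_, hf, by simpa using hfd, rfl⟩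
    refine (V.avg_of_forall_eq _ _ _ fun ζ => hfd fun i hi => ov_apply_notMem x ζ ?_).symm
    simp only [Set.mem_Iic] at hi
    simp only [Finset.mem_Icc]
    omega
  | succ k ih =>
    obtain ⟨h, hlim, hh, hd, hint⟩ := ih
    have hhC : ∀ x, |h x| ≤ C := fun x =>
      le_of_tendsto (hlim x).abs (Eventually.of_forall fun N => V.abs_avg_le _ _ x hC)
    have h1 : n + 1 - ((k + 1 : ℕ) : ℤ) = n - k := by push_cast; ring
    have h2 : n - ((k + 1 : ℕ) : ℤ) = n - k - 1 := by push_cast; ring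
    have h3 : n + 1 - (k : ℤ) = n - k + 1 := by ring
    rw [h3] at hlim
    rw [h1, h2]
    exact ⟨chainStep g (n - k) h, tendsto_avg_Icc_chainStep hinv hg hlim,
      measurable_chainStep hgm _ hh, dependsOn_chainStep hgd hd,
      (integral_chainStep hμ hgm (abs_limit_le_one hg) hh hd hhC).trans hint⟩

lemma IsGChain.tendsto_integral_avg (hμ : IsGChain g μ) (hinv : V.TInvariant)
    (hg : ∀ x : Conf S, Tendsto (fun n : ℕ => piG V n x) atTop (nhds (g x)))
    (hgm : Measurable g) (hgd : DependsOn g (Set.Iic (0 : ℤ)))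
    {n : ℤ} {f : Conf S → ℝ} (hf : Measurable f) (hfd : DependsOn f (Set.Iic n))
    {C : ℝ} (hC : ∀ x, |f x| ≤ C) (m : ℤ) :
    Tendsto (fun N : ℤ => ∫ x, V.avg (Finset.Icc m N) f x ∂μ) atTop
      (nhds (∫ x, f x ∂μ)) := by
  have := hμ.1
  have hmax : DependsOn f (Set.Iic (max n m)) := fun x y hxy =>
    hfd fun i hi => hxy i (Set.mem_Iic.2 (le_trans hi (le_max_left _ _)))
  obtain ⟨h, hlim, -, -, hint⟩ :=
    hμ.exists_tendsto_avg hinv hg hgm hgd hf hmax hC (max n m + 1 - m).toNat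
  have hm : max n m + 1 - ((max n m + 1 - m).toNat : ℤ) = m := by omega
  rw [hm] at hlim
  rw [← hint]
  exact tendsto_integral_filter_of_dominated_convergence (fun _ => C)
    (Eventually.of_forall fun N => (V.measurable_avg _ hf).aestronglyMeasurable)
    (Eventually.of_forall fun N => ae_of_all _ fun x => V.abs_avg_le _ _ _ hC)
    (integrable_const _) (ae_of_all _ hlim)

/-- A continuous function is uniformly close to one that ignores the far right coordinates. -/
lemma exists_dependsOn_abs_sub_le {f : Conf S → ℝ} (hf : Continuous f) {ε : ℝ} (hε : 0 < ε) :
    ∃ (n : ℤ) (u : Conf S → ℝ), Continuous u ∧ DependsOn u (Set.Iic n) ∧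
      ∀ x, |f x - u x| ≤ ε := by
  let c : S := Classical.arbitrary S
  have hS : ‹TopologicalSpace S› = ⊥ := DiscreteTopology.eq_bot
  subst hS
  let _ : UniformSpace S := ⊥
  let r : ℕ → Conf S → Conf S := fun n x i => if i ≤ n then x i else c
  have hr : ∀ n, Continuous (r n) := fun n => continuous_pi fun i => by
    by_cases hi : i ≤ n
    · simp only [r, hi, if_true]
      exact continuous_apply i
    · simp only [r, hi, if_false]
      exact continuous_const
  have hu : TendstoUniformly r id atTop := by
    rw [tendstoUniformly_iff_tendsto, Pi.uniformity, tendsto_iInf]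
    intro i
    rw [tendsto_comap_iff]
    refine tendsto_def.2 fun U hU => ?_
    have : ∀ᶠ p : ℕ × Conf S in atTop ×ˢ ⊤, i ≤ (p.1 : ℤ) :=
      Filter.Eventually.prod_inl (p := fun n : ℕ => i ≤ (n : ℤ))
        ((eventually_ge_atTop i.toNat).mono fun n hn => by omega) _
    filter_upwards [this] with p hp
    simpa [r, hp] using refl_mem_uniformity hU
  have hfu := (CompactSpace.uniformContinuous_of_continuous hf).comp_tendstoUniformly hu
  obtain ⟨n, hn⟩ := (Metric.tendstoUniformly_iff.1 hfu ε hε).exists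
  refine ⟨n, f ∘ r n, hf.comp (hr n), fun x y hxy => ?_, fun x => (hn x).le⟩
  refine congr_arg f (funext fun i => ?_)
  by_cases hi : i ≤ n
  · simp [r, hi, hxy i hi]
  · simp [r, hi]

lemma abs_integral_sub_le [IsProbabilityMeasure μ] {f h : Conf S → ℝ} (hf : Integrable f μ)
    (hh : Integrable h μ) {ε : ℝ} (hε : ∀ x, |f x - h x| ≤ ε) :
    |∫ x, f x ∂μ - ∫ x, h x ∂μ| ≤ ε := by
  rw [← integral_sub hf hh]
  simpa using norm_integral_le_of_norm_le_const (μ := μ) (f := fun x => f x - h x)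
    (ae_of_all _ hε)

lemma exists_abs_le_of_continuous {f : Conf S → ℝ} (hf : Continuous f) :
    ∃ C, ∀ x, |f x| ≤ C := by
  obtain ⟨C, hC⟩ := isCompact_univ.exists_bound_of_continuousOn hf.continuousOn
  exact ⟨C, fun x => hC x (Set.mem_univ x)⟩

lemma IsGChain.tendsto_integral_avg_of_continuous (hμ : IsGChain g μ) (hinv : V.TInvariant)
    (hg : ∀ x : Conf S, Tendsto (fun n : ℕ => piG V n x) atTop (nhds (g x)))
    (hgm : Measurable g) (hgd : DependsOn g (Set.Iic (0 : ℤ)))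
    [BorelSpace (Conf S)] {f : Conf S → ℝ} (hf : Continuous f) (m : ℤ) :
    Tendsto (fun N : ℤ => ∫ x, V.avg (Finset.Icc m N) f x ∂μ) atTop
      (nhds (∫ x, f x ∂μ)) := by
  have := hμ.1
  refine Metric.tendsto_nhds.2 fun ε hε => ?_
  obtain ⟨n, u, hu, hud, hfu⟩ := exists_dependsOn_abs_sub_le hf (by positivity : 0 < ε / 4)
  obtain ⟨C, hC⟩ := exists_abs_le_of_continuous hf
  obtain ⟨D, hD⟩ := exists_abs_le_of_continuous hu
  have hfi := integrable_of_abs_le (μ := μ) hf.measurable hC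
  have hui := integrable_of_abs_le (μ := μ) hu.measurable hD
  filter_upwards [Metric.tendsto_nhds.1
    (hμ.tendsto_integral_avg hinv hg hgm hgd hu.measurable hud hD m) (ε / 4)
    (by positivity)] with N hN
  have h1 := abs_integral_sub_le hfi hui hfu
  have h2 := abs_integral_sub_le (μ := μ)
    (integrable_of_abs_le (V.measurable_avg (Finset.Icc m N) hf.measurable)
      fun x => V.abs_avg_le _ _ x hC)
    (integrable_of_abs_le (V.measurable_avg (Finset.Icc m N) hu.measurable)
      fun x => V.abs_avg_le _ _ x hD)
    fun x => V.abs_avg_sub_le _ f u x hfu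
  rw [Real.dist_eq] at hN ⊢
  rw [abs_le] at h1 h2
  rw [abs_lt] at hN ⊢
  constructor <;> linarith

lemma IsGChain.isGibbs (hμ : IsGChain g μ) (hcont : V.IsCont) (hinv : V.TInvariant)
    (hg : ∀ x : Conf S, Tendsto (fun n : ℕ => piG V n x) atTop (nhds (g x)))
    (hgm : Measurable g) (hgd : DependsOn g (Set.Iic (0 : ℤ))) [BorelSpace (Conf S)] :
    IsGibbs V μ := by
  have := hμ.1
  refine ⟨hμ.1, gibbsCond_of_integral_avg V μ fun Λ f hf hf1 =>
    integral_avg_of_continuous V μ Λ (fun u hu => ?_) hf hf1⟩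
  obtain ⟨m, hm⟩ := Λ.bddBelow
  obtain ⟨M, hM⟩ := Λ.bddAbove
  refine tendsto_nhds_unique_of_eventuallyEq
    (hμ.tendsto_integral_avg_of_continuous hinv hg hgm hgd (V.continuous_avg hcont Λ hu) m)
    (hμ.tendsto_integral_avg_of_continuous hinv hg hgm hgd hu m) ?_
  filter_upwards [eventually_ge_atTop M] with N hN
  have hsub : Λ ⊆ Finset.Icc m N := fun i hi =>
    Finset.mem_Icc.2 ⟨hm hi, (hM hi).trans hN⟩
  simp only [V.avg_avg hsub]

end Chains

/-- **Proposition 4.1.**  If `π^𝒱_{[0,n]}([x]_{{0}} | x)` converges pointwise to a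
continuous limit `g`, then `g` is a strictly positive member of `𝒢_X` and the Gibbs
states of `𝒱` are exactly the `g`-chains. -/
theorem gibbs_iff_gchain_of_continuous_limit
    {S : Type} [Fintype S] [Nonempty S] [DecidableEq S]
    [TopologicalSpace S] [DiscreteTopology S]
    [MeasurableSpace S] [MeasurableSingletonClass S]
    (V : Specification S) (hpos : V.Positive) (hcont : V.IsCont)
    (hinv : V.TInvariant) (g : Conf S → ℝ)
    (hg : ∀ x : Conf S, Tendsto (fun n : ℕ => piG V n x) atTop (nhds (g x)))
    (hgcont : Continuous g) :
    (∀ x, 0 < g x) ∧ Measurable[cylSA (Set.Iic (0 : ℤ))] g ∧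
      (∀ x : Conf S, ∑ s : S, g (upd s 0 x) = 1) ∧ MemG g ∧
      ∀ μ : Measure (Conf S), IsGibbs V μ ↔ IsGChain g μ := by
  have := borelSpace_conf (S := S)
  have hgm : Measurable g := hgcont.measurable
  have hgd : DependsOn g (Set.Iic (0 : ℤ)) := dependsOn_limit hg hgcont
  have hg0 : ∀ x, 0 < g x := limit_pos hpos hcont hg
  have hgS : Measurable[cylSA (Set.Iic (0 : ℤ))] g := measurable_cylSA_of_dependsOn hgm hgd
  refine ⟨hg0, hgS, sum_limit_upd hg,
    ⟨⟨1, abs_limit_le_one hg⟩, fun x => (hg0 x).le, hgS, sum_limit_upd hg⟩, fun μ => ⟨?_, ?_⟩⟩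
  · rintro ⟨hprob, hμ⟩
    exact hμ.isGChain hinv hg hgm hgd
  · exact fun hμ => hμ.isGibbs hcont hinv hg hgm hgd

end GibbsFormal
end
end
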